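/- arXiv:0711.4079 — 7 statements merged into one kernel-verified Lean document; each statement's English description precedes it below -/
import Mathlib

section
/- Let n ≥ 1 and let σ_s(z) denote the s-th elementary symmetric polynomial in the variables z_1,…,z_n. For a = (a_1,…,a_n) ∈ ℂ^n let I_a ⊂ ℂ[z_1,…,z_n] be the ideal generated by σ_s(z) − a_s, s = 1,…,n. Then for every a ∈ ℂ^n, the quotient ℂ[z_1,…,z_n]/I_a, with the symmetric group S_n acting by permutation of the variables z_1,…,z_n, is isomorphic as a representation of S_n to the regular representation ℂ[S_n]. -/
open Module MvPolynomial
open scoped Pointwise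

lemma aux_homdim {G : Type} [Group G] [Fintype G] {W V : Type}
    [AddCommGroup W] [Module ℂ W] [Module (MonoidAlgebra ℂ G) W] [IsScalarTower ℂ (MonoidAlgebra ℂ G) W]
    [AddCommGroup V] [Module ℂ V] [Module (MonoidAlgebra ℂ G) V] [IsScalarTower ℂ (MonoidAlgebra ℂ G) V]
    [FiniteDimensional ℂ V] [FiniteDimensional ℂ W]
    (h1 : finrank ℂ V = Fintype.card G)
    (h2 : ∀ g : G, g ≠ 1 → LinearMap.trace ℂ V (Algebra.lsmul ℂ ℂ V (MonoidAlgebra.of ℂ G g)) = 0) :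
    finrank ℂ (W →ₗ[MonoidAlgebra ℂ G] V) = finrank ℂ W := by
  classical
  let ρ := Representation.ofModule' (k := ℂ) (G := G) W
  let σ := Representation.ofModule' (k := ℂ) (G := G) V
  have hρ : ∀ g w, ρ g w = MonoidAlgebra.single g (1:ℂ) • w := fun g w => rfl
  have hσ : ∀ g w, σ g w = MonoidAlgebra.single g (1:ℂ) • w := fun g w => rfl
  have hcard : (Nat.card G : ℂ) ≠ 0 := by simp
  have : Invertible (Nat.card G : ℂ) := invertibleOfNonzero hcard
  have key := Representation.card_inv_mul_sum_char_mul_char_eq_finrank ρ σ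
  rw [Finset.sum_eq_single 1] at key
  · rw [inv_one, Representation.char_one, Representation.char_one, h1, ← Nat.card_eq_fintype_card,
      inv_mul_cancel_left₀ hcard] at key
    have key' : finrank ℂ W = finrank ℂ (Representation.IntertwiningMap ρ σ) := by exact_mod_cast key
    rw [key']
    let e : (W →ₗ[MonoidAlgebra ℂ G] V) ≃ₗ[ℂ] Representation.IntertwiningMap ρ σ :=
      { toFun := fun f => ⟨f.restrictScalars ℂ, fun g => by ext w; simp [hρ, hσ]⟩
        invFun := fun f => MonoidAlgebra.equivariantOfLinearOfComm f.toLinearMap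
          (fun g v => f.isIntertwining _ _ g v)
        map_add' := fun _ _ => rfl
        map_smul' := fun _ _ => rfl
        left_inv := fun _ => rfl
        right_inv := fun _ => rfl }
    exact e.finrank_eq
  · intro g _ hg
    have : σ.character g = 0 := h2 g hg
    rw [this, zero_mul]
  · simp

lemma aux_finhom {G : Type} [Group G] [Fintype G] {W V : Type}
    [AddCommGroup W] [Module ℂ W] [Module (MonoidAlgebra ℂ G) W] [IsScalarTower ℂ (MonoidAlgebra ℂ G) W]
    [AddCommGroup V] [Module ℂ V] [Module (MonoidAlgebra ℂ G) V] [IsScalarTower ℂ (MonoidAlgebra ℂ G) V]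
    [FiniteDimensional ℂ V] [FiniteDimensional ℂ W] :
    Module.Finite ℂ (W →ₗ[MonoidAlgebra ℂ G] V) :=
  Module.Finite.of_injective (LinearMap.restrictScalarsₗ ℂ (MonoidAlgebra ℂ G) W V ℂ)
    (LinearMap.restrictScalars_injective ℂ)

lemma aux_trace_reg {G : Type} [Group G] [Fintype G] (g : G) (hg : g ≠ 1) :
    LinearMap.trace ℂ (MonoidAlgebra ℂ G)
      (Algebra.lsmul ℂ ℂ (MonoidAlgebra ℂ G) (MonoidAlgebra.of ℂ G g)) = 0 := by
  classical
  let b : Basis G ℂ (MonoidAlgebra ℂ G) := ⟨MonoidAlgebra.coeffLinearEquiv ℂ⟩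
  rw [LinearMap.trace_eq_matrix_trace ℂ b, Matrix.trace]
  apply Finset.sum_eq_zero
  intro x _
  rw [Matrix.diag_apply, LinearMap.toMatrix_apply]
  have hb : b x = MonoidAlgebra.single x 1 := rfl
  have hb' : ∀ (v : MonoidAlgebra ℂ G) (y : G), b.repr v y = v.coeff y := fun _ _ => rfl
  rw [hb, hb']
  simp [MonoidAlgebra.single_mul_single, hg]

lemma aux_notinj {G : Type} [Group G] [Fintype G] {V K M : Type}
    [AddCommGroup V] [Module ℂ V] [Module (MonoidAlgebra ℂ G) V] [IsScalarTower ℂ (MonoidAlgebra ℂ G) V]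
    [AddCommGroup K] [Module ℂ K] [Module (MonoidAlgebra ℂ G) K] [IsScalarTower ℂ (MonoidAlgebra ℂ G) K]
    [AddCommGroup M] [Module ℂ M] [Module (MonoidAlgebra ℂ G) M] [IsScalarTower ℂ (MonoidAlgebra ℂ G) M]
    [FiniteDimensional ℂ V] [FiniteDimensional ℂ K] [FiniteDimensional ℂ M]
    (h1 : finrank ℂ V = Fintype.card G)
    (h2 : ∀ g : G, g ≠ 1 → LinearMap.trace ℂ V (Algebra.lsmul ℂ ℂ V (MonoidAlgebra.of ℂ G g)) = 0)
    (hA : finrank ℂ (MonoidAlgebra ℂ G) = Fintype.card G)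
    (j : K →ₗ[MonoidAlgebra ℂ G] MonoidAlgebra ℂ G) (hj : j ≠ 0)
    (f : MonoidAlgebra ℂ G →ₗ[MonoidAlgebra ℂ G] M) (hf : Function.Surjective f)
    (hfj : f ∘ₗ j = 0)
    (i : V →ₗ[MonoidAlgebra ℂ G] M)
    (hcon : ∀ h : K →ₗ[MonoidAlgebra ℂ G] V, h ≠ 0 → i ∘ₗ h ≠ 0) : False := by
  have : NeZero (Nat.card G : ℂ) := ⟨by simp⟩
  have hfin1 : Module.Finite ℂ (K →ₗ[MonoidAlgebra ℂ G] MonoidAlgebra ℂ G) := aux_finhom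
  have hfin2 : Module.Finite ℂ (K →ₗ[MonoidAlgebra ℂ G] M) := aux_finhom
  have hd1 : finrank ℂ (K →ₗ[MonoidAlgebra ℂ G] V) = finrank ℂ K := aux_homdim h1 h2
  have hd2 : finrank ℂ (K →ₗ[MonoidAlgebra ℂ G] MonoidAlgebra ℂ G) = finrank ℂ K :=
    aux_homdim hA aux_trace_reg
  let Φ : (K →ₗ[MonoidAlgebra ℂ G] V) →ₗ[ℂ] (K →ₗ[MonoidAlgebra ℂ G] M) :=
    { toFun := fun h => i ∘ₗ h
      map_add' := fun _ _ => LinearMap.comp_add _ _ _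
      map_smul' := fun c h => by
        ext x
        simp [LinearMap.map_smul_of_tower] }
  let Ψ : (K →ₗ[MonoidAlgebra ℂ G] MonoidAlgebra ℂ G) →ₗ[ℂ] (K →ₗ[MonoidAlgebra ℂ G] M) :=
    { toFun := fun h => f ∘ₗ h
      map_add' := fun _ _ => LinearMap.comp_add _ _ _
      map_smul' := fun c h => by
        ext x
        simp [LinearMap.map_smul_of_tower] }
  have hΦ : Function.Injective Φ := by
    rw [← LinearMap.ker_eq_bot, LinearMap.ker_eq_bot']
    intro h hh
    by_contra h0
    exact hcon h h0 hh
  have hΨ : Function.Surjective Ψ := by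
    intro u
    have : Module.Projective (MonoidAlgebra ℂ G) M :=
      Module.projective_of_isSemisimpleRing _ _
    obtain ⟨s, hs⟩ := Module.projective_lifting_property f LinearMap.id hf
    refine ⟨s ∘ₗ u, ?_⟩
    change f ∘ₗ (s ∘ₗ u) = u
    rw [← LinearMap.comp_assoc, hs, LinearMap.id_comp]
  have e1 := LinearMap.finrank_le_finrank_of_injective hΦ
  have e2 := LinearMap.finrank_range_add_finrank_ker Ψ
  rw [LinearMap.range_eq_top.2 hΨ, finrank_top] at e2
  have e3 : 0 < finrank ℂ (LinearMap.ker Ψ) := by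
    have : Nontrivial (LinearMap.ker Ψ) :=
      ⟨⟨⟨j, hfj⟩, 0, fun h => hj (congrArg Subtype.val h)⟩⟩
    exact finrank_pos (R := ℂ) (M := LinearMap.ker Ψ)
  omega

lemma aux_iso {G : Type} [Group G] [Fintype G] {V : Type}
    [AddCommGroup V] [Module ℂ V] [Module (MonoidAlgebra ℂ G) V] [IsScalarTower ℂ (MonoidAlgebra ℂ G) V]
    [FiniteDimensional ℂ V]
    (h1 : finrank ℂ V = Fintype.card G)
    (h2 : ∀ g : G, g ≠ 1 → LinearMap.trace ℂ V (Algebra.lsmul ℂ ℂ V (MonoidAlgebra.of ℂ G g)) = 0) :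
    Nonempty (V ≃ₗ[MonoidAlgebra ℂ G] MonoidAlgebra ℂ G) := by
  classical
  have : FiniteDimensional ℂ (MonoidAlgebra ℂ G) := inferInstance
  have hA : finrank ℂ (MonoidAlgebra ℂ G) = Fintype.card G :=
    finrank_eq_card_basis (⟨MonoidAlgebra.coeffLinearEquiv ℂ⟩ : Basis G ℂ (MonoidAlgebra ℂ G))
  have : NeZero (Nat.card G : ℂ) := ⟨by simp⟩
  obtain ⟨f, hf⟩ : ∃ f : MonoidAlgebra ℂ G →ₗ[MonoidAlgebra ℂ G] V, ∀ f' : MonoidAlgebra ℂ G →ₗ[MonoidAlgebra ℂ G] V,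
      ¬ (LinearMap.ker f' < LinearMap.ker f) := by
    have hwf : WellFoundedLT (Submodule (MonoidAlgebra ℂ G) (MonoidAlgebra ℂ G)) := inferInstance
    obtain ⟨m, ⟨f, rfl⟩, hm⟩ := hwf.wf.has_min (Set.range fun f : MonoidAlgebra ℂ G →ₗ[MonoidAlgebra ℂ G] V => LinearMap.ker f) ⟨_, ⟨0, rfl⟩⟩
    exact ⟨f, fun f' h => hm _ ⟨f', rfl⟩ h⟩
  have hinj : LinearMap.ker f = ⊥ := by
    by_contra hK
    obtain ⟨π, hπ⟩ := MonoidAlgebra.exists_leftInverse_of_injective (k := ℂ) (LinearMap.ker f).subtype (Submodule.ker_subtype _)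
    obtain ⟨i, hi⟩ := MonoidAlgebra.exists_leftInverse_of_injective (k := ℂ) (LinearMap.range f).subtype (Submodule.ker_subtype _)
    -- a nonzero map K → V killed by i
    obtain ⟨h, hh0, hh⟩ : ∃ h : LinearMap.ker f →ₗ[MonoidAlgebra ℂ G] V, h ≠ 0 ∧ i ∘ₗ h = 0 := by
      by_contra! hcon
      have hfinr : FiniteDimensional ℂ (LinearMap.range f) :=
        Module.Finite.of_surjective (f.rangeRestrict.restrictScalars ℂ) f.surjective_rangeRestrict
      refine aux_notinj h1 h2 hA (LinearMap.ker f).subtype ?_ f.rangeRestrict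
        f.surjective_rangeRestrict ?_ i hcon
      · intro h0
        apply hK
        rw [eq_bot_iff]
        intro x hx
        exact LinearMap.congr_fun h0 ⟨x, hx⟩
      · ext x
        exact x.2
    apply hf (f + h ∘ₗ π)
    have hker : ∀ x, (f + h ∘ₗ π) x = 0 → f x = 0 ∧ h (π x) = 0 := by
      intro x hx
      have h1 : i (f x + h (π x)) = 0 := by
        have := congrArg i hx
        simpa using this
      have h2 : i (h (π x)) = 0 := LinearMap.congr_fun hh (π x)
      have h3 : i (f x) = ⟨f x, x, rfl⟩ := LinearMap.congr_fun hi ⟨f x, x, rfl⟩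
      rw [map_add, h2, h3, add_zero] at h1
      have h4 : f x = 0 := congrArg Subtype.val h1
      refine ⟨h4, ?_⟩
      simpa [h4] using hx
    refine lt_of_le_of_ne (fun x hx => (hker x hx).1) fun heq => hh0 ?_
    ext y
    have hy : (y : MonoidAlgebra ℂ G) ∈ LinearMap.ker (f + h ∘ₗ π) := by rw [heq]; exact y.2
    have := (hker _ hy).2
    have h3 : π y = y := LinearMap.congr_fun hπ y
    rwa [h3] at this
  have hinj' : Function.Injective f := LinearMap.ker_eq_bot.1 hinj
  have hsurj : Function.Surjective (f.restrictScalars ℂ) :=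
    (LinearMap.injective_iff_surjective_of_finrank_eq_finrank (by rw [hA, h1])).1 hinj'
  exact ⟨(LinearEquiv.ofBijective f ⟨hinj', hsurj⟩).symm⟩

lemma aux_rep {G : Type} [Group G] [Fintype G] {V : Type}
    [AddCommGroup V] [Module ℂ V] [FiniteDimensional ℂ V] (ρ : Representation ℂ G V)
    (h1 : finrank ℂ V = Fintype.card G)
    (h2 : ∀ g : G, g ≠ 1 → LinearMap.trace ℂ V (ρ g) = 0) :
    ∃ e : V ≃ₗ[ℂ] MonoidAlgebra ℂ G, ∀ g v, e (ρ g v) = MonoidAlgebra.of ℂ G g * e v := by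
  let : Module (MonoidAlgebra ℂ G) V := Module.compHom V ρ.asAlgebraHom.toRingHom
  have hs : ∀ (x : MonoidAlgebra ℂ G) (v : V), x • v = ρ.asAlgebraHom x v := fun _ _ => rfl
  have : IsScalarTower ℂ (MonoidAlgebra ℂ G) V := ⟨fun c x v => by
    rw [hs, hs, map_smul, LinearMap.smul_apply]⟩
  have hof : ∀ g, Algebra.lsmul ℂ ℂ V (MonoidAlgebra.of ℂ G g) = ρ g := by
    intro g
    ext v
    change MonoidAlgebra.of ℂ G g • v = _
    rw [hs, Representation.asAlgebraHom_of]
  obtain ⟨e⟩ := aux_iso (G := G) (V := V) h1 (fun g hg => by rw [hof]; exact h2 g hg)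
  refine ⟨e.restrictScalars ℂ, fun g v => ?_⟩
  rw [← hof]
  exact e.map_smul _ _

abbrev SymSub (n : ℕ) := MvPolynomial.symmetricSubalgebra (Fin n) ℂ

@[reducible] noncomputable def permAct (n : ℕ) : MulSemiringAction (Equiv.Perm (Fin n)) (MvPolynomial (Fin n) ℂ) where
  smul σ p := rename σ p
  one_smul p := rename_id_apply p
  mul_smul σ τ p := (rename_rename τ σ p).symm
  smul_zero _ := map_zero _
  smul_add _ p q := map_add _ p q
  smul_one _ := map_one _
  smul_mul _ p q := map_mul _ p q

lemma aux_gal_finrank (G A B : Type) [Group G] [Finite G] [CommRing A] [CommRing B] [IsDomain A]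
    [IsDomain B] [Algebra A B] [FaithfulSMul A B] [MulSemiringAction G B] [IsGaloisGroup G A B] :
    finrank A B = Nat.card G := by
  let : Algebra (FractionRing A) (FractionRing B) := FractionRing.liftAlgebra _ _
  have : IsScalarTower A (FractionRing A) (FractionRing B) :=
    FractionRing.isScalarTower_liftAlgebra _ _
  let := IsFractionRing.mulSemiringAction G B (FractionRing B)
  have h := IsGaloisGroup.card_eq_finrank G (FractionRing A) (FractionRing B)
  rw [← IsFractionRing.finrank_eq A (FractionRing A) B (FractionRing B), ← h]

lemma aux_finrank (n : ℕ) : finrank (SymSub n) (MvPolynomial (Fin n) ℂ) = n.factorial := by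
  let := permAct n
  have hsm : ∀ (σ : Equiv.Perm (Fin n)) (p : MvPolynomial (Fin n) ℂ), σ • p = rename σ p :=
    fun _ _ => rfl
  have hG : IsGaloisGroup (Equiv.Perm (Fin n)) (SymSub n) (MvPolynomial (Fin n) ℂ) :=
    { faithful := ⟨fun {σ τ} h => by
        ext i
        have := h (X i)
        rw [hsm, hsm, rename_X, rename_X] at this
        rw [X_injective this]⟩
      commutes := ⟨fun σ a p => by
        rw [Algebra.smul_def, Algebra.smul_def, hsm, hsm, map_mul]
        congr 1
        exact a.2 σ⟩
      isInvariant := ⟨fun p hp => ⟨⟨p, hp⟩, rfl⟩⟩ }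
  rw [aux_gal_finrank (Equiv.Perm (Fin n)) (SymSub n) (MvPolynomial (Fin n) ℂ)]
  simp [Nat.card_eq_fintype_card, Fintype.card_perm]

lemma aux_div {S R : Type} [CommRing S] [CommRing R] (f : S →+* R) (P Q D : Polynomial R)
    (h : Q * D = P) (hQm : Q.Monic) (hP : P ∈ Polynomial.lifts f) (hQ : Q ∈ Polynomial.lifts f) :
    D ∈ Polynomial.lifts f := by
  cases subsingleton_or_nontrivial R
  · exact (Polynomial.mem_lifts _).2 ⟨0, Subsingleton.elim _ _⟩
  obtain ⟨P', hP'⟩ := (Polynomial.mem_lifts _).1 hP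
  obtain ⟨Q', hQ', -, hQ'm⟩ := Polynomial.lifts_and_natDegree_eq_and_monic hQ hQm
  refine (Polynomial.mem_lifts _).2 ⟨P' /ₘ Q', ?_⟩
  rw [Polynomial.map_divByMonic _ hQ'm, hP', hQ', ← h, Polynomial.mul_divByMonic_cancel_left _ hQm]

lemma aux_lifts {A R : Type} [CommRing A] [CommRing R] [Algebra A R] {n : ℕ} (z : Fin n → R)
    (hP : ∏ i, (Polynomial.X - Polynomial.C (z i)) ∈ Polynomial.lifts (algebraMap A R))
    (k : ℕ) (B : Subalgebra A R)
    (hB : ∀ i : Fin n, (i : ℕ) < k → z i ∈ B) :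
    (∏ i ∈ Finset.univ.filter (fun i : Fin n => ¬ (i : ℕ) < k),
      (Polynomial.X - Polynomial.C (z i))) ∈ Polynomial.lifts (algebraMap B R) := by
  classical
  refine aux_div (algebraMap B R) _ (∏ i ∈ Finset.univ.filter (fun i : Fin n => (i : ℕ) < k),
      (Polynomial.X - Polynomial.C (z i))) _ (Finset.prod_filter_mul_prod_filter_not _ _ _)
      (Polynomial.monic_prod_of_monic _ _ fun i _ => Polynomial.monic_X_sub_C _) ?_ ?_
  · obtain ⟨P', hP'⟩ := (Polynomial.mem_lifts _).1 hP
    refine (Polynomial.mem_lifts _).2 ⟨P'.map (algebraMap A B), ?_⟩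
    rw [Polynomial.map_map, ← IsScalarTower.algebraMap_eq, hP']
  · apply prod_mem
    intro i hi
    have hi' := hB i (Finset.mem_filter.1 hi).2
    refine (Polynomial.mem_lifts (f := algebraMap B R) _).2 ⟨Polynomial.X - Polynomial.C (⟨z i, hi'⟩ : B), ?_⟩
    rw [Polynomial.map_sub, Polynomial.map_X, Polynomial.map_C]
    rfl

lemma aux_card {n : ℕ} (k : ℕ) :
    (Finset.univ.filter (fun i : Fin n => ¬ (i : ℕ) < k)).card = n - k := by
  have h := Finset.card_filter_add_card_filter_not (s := (Finset.univ : Finset (Fin n)))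
    (fun i : Fin n => (i : ℕ) < k)
  have h2 : (Finset.univ.filter (fun i : Fin n => (i : ℕ) < k)).card = min n k := by
    rw [Fin.card_filter_val_lt]
  simp only [Finset.card_univ, Fintype.card_fin] at h
  omega

lemma aux_span {A R : Type} [CommRing A] [CommRing R] [Nontrivial R] [Algebra A R] {n : ℕ} (z : Fin n → R)
    (hP : ∏ i, (Polynomial.X - Polynomial.C (z i)) ∈ Polynomial.lifts (algebraMap A R))
    (k : ℕ) (hk : k ≤ n) : ∃ T : Finset R,
    T.card ≤ n.descFactorial k ∧ Submodule.span A (T : Set R) =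
      Subalgebra.toSubmodule (Algebra.adjoin A {p | ∃ i : Fin n, (i : ℕ) < k ∧ z i = p}) := by
  classical
  induction k with
  | zero =>
    refine ⟨{1}, by simp, ?_⟩
    simp [Algebra.toSubmodule_bot, Submodule.one_eq_span]
  | succ k ih =>
    obtain ⟨T, hT, hspan⟩ := ih (by omega)
    set B := Algebra.adjoin A {p | ∃ i : Fin n, (i : ℕ) < k ∧ z i = p} with hBdef
    set w : R := z ⟨k, hk⟩ with hw
    refine ⟨T * (Finset.range (n - k)).image (fun j => w ^ j), ?_, ?_⟩
    · refine Finset.card_mul_le.trans ?_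
      rw [Nat.descFactorial_succ, mul_comm]
      refine Nat.mul_le_mul (Finset.card_image_le.trans (by simp)) hT
    · have hset : {p | ∃ i : Fin n, (i : ℕ) < k + 1 ∧ z i = p} =
          {p | ∃ i : Fin n, (i : ℕ) < k ∧ z i = p} ∪ {w} := by
        ext p
        simp only [Set.mem_ofPred_eq, Set.mem_union, Set.mem_singleton_iff]
        constructor
        · rintro ⟨i, hi, rfl⟩
          rcases Nat.lt_succ_iff_lt_or_eq.1 hi with h | h
          · exact Or.inl ⟨i, h, rfl⟩
          · right
            rw [hw]
            congr 1
            exact Fin.ext h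
        · rintro (⟨i, hi, rfl⟩ | rfl)
          · exact ⟨i, by omega, rfl⟩
          · exact ⟨⟨k, hk⟩, by simp, rfl⟩
      rw [hset, Algebra.adjoin_union_coe_submodule, Finset.coe_mul, ← Submodule.span_mul_span, hspan]
      apply le_antisymm
      · refine mul_le_mul' le_rfl ?_
        rw [Submodule.span_le]
        intro p hp
        simp only [Finset.coe_image, Set.mem_image] at hp
        obtain ⟨j, -, rfl⟩ := hp
        change w ^ j ∈ Algebra.adjoin A {w}
        exact Subalgebra.pow_mem _ (Algebra.self_mem_adjoin_singleton A w) j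
      · have hD := aux_lifts z hP k B (fun i hi => Algebra.subset_adjoin ⟨i, hi, rfl⟩)
        obtain ⟨D, hD1, hD2, hD3⟩ := Polynomial.lifts_and_natDegree_eq_and_monic hD
          (Polynomial.monic_prod_of_monic _ _ fun i _ => Polynomial.monic_X_sub_C _)
        have hdeg : D.natDegree = n - k := by
          rw [hD2, Polynomial.natDegree_prod_of_monic _ _ fun i _ => Polynomial.monic_X_sub_C _]
          simp only [Polynomial.natDegree_X_sub_C, Finset.sum_const, smul_eq_mul, mul_one]
          exact aux_card k
        have hroot : Polynomial.aeval w D = 0 := by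
          rw [Polynomial.aeval_def, ← Polynomial.eval_map, hD1, Polynomial.eval_prod]
          apply Finset.prod_eq_zero (i := ⟨k, hk⟩) (by simp)
          simp [hw]
        have hadj := Submodule.span_range_natDegree_eq_adjoin hD3 hroot
        rw [hdeg] at hadj
        rw [Submodule.mul_le]
        intro b hb v hv
        have hv' : v ∈ Algebra.adjoin B {w} := by
          have : Algebra.adjoin A {w} ≤ (Algebra.adjoin B {w}).restrictScalars A :=
            Algebra.adjoin_le (Algebra.subset_adjoin)
          exact this hv
        have hbw : b * v ∈ Submodule.span B (((Finset.range (n-k)).image (fun j => w ^ j) : Finset R) : Set R) := by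
          rw [hadj]
          rw [Subalgebra.mem_toSubmodule]
          exact mul_mem ((Algebra.adjoin B {w}).algebraMap_mem ⟨b, hb⟩) hv'
        generalize b * v = u at hbw
        induction hbw using Submodule.span_induction with
        | mem x hx =>
          rw [← one_mul x]
          exact Submodule.mul_mem_mul (one_mem B) (Submodule.subset_span hx)
        | zero => exact zero_mem _
        | add x y _ _ hx hy => exact add_mem hx hy
        | smul c x _ hx =>
          rw [Algebra.smul_def]
          have h2 : (algebraMap B R) c * x ∈ Subalgebra.toSubmodule B * (Subalgebra.toSubmodule B * Submodule.span A (((Finset.range (n-k)).image (fun j => w ^ j) : Finset R) : Set R)) := Submodule.mul_mem_mul c.2 hx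
          rw [← mul_assoc, Subalgebra.isIdempotentElem_toSubmodule B] at h2
          exact h2

lemma aux_lifts_sym (n : ℕ) :
    ∏ i : Fin n, (Polynomial.X - Polynomial.C (X i : MvPolynomial (Fin n) ℂ)) ∈
      Polynomial.lifts (algebraMap (SymSub n) (MvPolynomial (Fin n) ℂ)) := by
  set P : Polynomial (MvPolynomial (Fin n) ℂ) := ∏ i : Fin n, (Polynomial.X - Polynomial.C (X i))
  rw [Polynomial.lifts_iff_coeff_lifts]
  intro m
  have hs : (P.coeff m).IsSymmetric := by
    intro σ
    have : P.map (rename σ : MvPolynomial (Fin n) ℂ →ₐ[ℂ] _).toRingHom = P := by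
      simp only [P, Polynomial.map_prod, Polynomial.map_sub, Polynomial.map_X, Polynomial.map_C]
      simp only [AlgHom.toRingHom_eq_coe, RingHom.coe_coe, rename_X]
      exact Equiv.prod_comp σ fun i => (Polynomial.X - Polynomial.C (X i : MvPolynomial (Fin n) ℂ))
    conv_rhs => rw [← this]
    rw [Polynomial.coeff_map]
    rfl
  exact ⟨⟨_, hs⟩, rfl⟩

lemma aux_basis (n : ℕ) : Nonempty (Basis (Fin n.factorial) (SymSub n) (MvPolynomial (Fin n) ℂ)) := by
  classical
  obtain ⟨T, hT, hs⟩ := aux_span (A := SymSub n) (fun i : Fin n => (X i : MvPolynomial (Fin n) ℂ))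
    (aux_lifts_sym n) n (le_refl n)
  rw [Nat.descFactorial_self] at hT
  have htop : Algebra.adjoin (SymSub n) {p | ∃ i : Fin n, (i : ℕ) < n ∧ (X i : MvPolynomial (Fin n) ℂ) = p} = ⊤ := by
    rw [eq_top_iff]
    intro p _
    induction p using MvPolynomial.induction_on with
    | C c => exact (Algebra.adjoin (SymSub n) _).algebraMap_mem (algebraMap ℂ (SymSub n) c)
    | add p q hp hq => exact add_mem (hp trivial) (hq trivial)
    | mul_X p i hp => exact mul_mem (hp trivial) (Algebra.subset_adjoin ⟨i, i.2, rfl⟩)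
  rw [htop, Algebra.top_toSubmodule] at hs
  have hfr := aux_finrank n
  have hb : ⊤ ≤ Submodule.span (SymSub n) (Set.range (Subtype.val : T → MvPolynomial (Fin n) ℂ)) := by
    rw [Subtype.range_coe_subtype]
    exact hs.ge
  have hle : Fintype.card T ≤ finrank (SymSub n) (MvPolynomial (Fin n) ℂ) := by
    rw [hfr]; simpa using hT
  have hli := linearIndependent_of_top_le_span_of_card_le_finrank hb hle
  let b := Basis.mk hli hb
  have hc : Fintype.card T = n.factorial := by rw [← hfr, finrank_eq_card_basis b]
  exact ⟨b.reindex (Fintype.equivFinOfCardEq hc)⟩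

lemma aux_trace_zero {S R : Type} [CommRing S] [IsDomain S] [CommRing R] [Algebra S R]
    [Module.Finite S R] [Module.Free S R]
    (s : R →ₐ[S] R) (x y : R) (d : S) (hd : d ≠ 0) (h : (x - s x) * y = algebraMap S R d) :
    LinearMap.trace S R s.toLinearMap = 0 := by
  let m : R → (R →ₗ[S] R) := fun r => LinearMap.mulLeft S r
  have e1 : LinearMap.trace S R (m x * (s.toLinearMap * m y)) =
      LinearMap.trace S R ((s.toLinearMap * m y) * m x) := LinearMap.trace_mul_comm _ _ _
  have e2 : (s.toLinearMap * m y) * m (x - s x) = d • s.toLinearMap := by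
    ext r
    simp only [m, Module.End.mul_apply, LinearMap.mulLeft_apply, AlgHom.toLinearMap_apply,
      LinearMap.smul_apply]
    rw [← mul_assoc, mul_comm y, h, ← Algebra.smul_def, map_smul]
  have e3 : LinearMap.trace S R (m (s x) * (s.toLinearMap * m y)) =
      LinearMap.trace S R ((s.toLinearMap * m y) * m (s x)) := LinearMap.trace_mul_comm _ _ _
  have e4 : m (s x) * (s.toLinearMap * m y) = (s.toLinearMap * m y) * m x := by
    ext r
    simp only [m, Module.End.mul_apply, LinearMap.mulLeft_apply, AlgHom.toLinearMap_apply, map_mul]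
    ring
  have e5 : (s.toLinearMap * m y) * m (x - s x) =
      (s.toLinearMap * m y) * m x - (s.toLinearMap * m y) * m (s x) := by
    ext r
    simp only [m, Module.End.mul_apply, LinearMap.mulLeft_apply, AlgHom.toLinearMap_apply,
      LinearMap.sub_apply, ← map_sub]
    congr 1
    ring
  have e6 : d • LinearMap.trace S R s.toLinearMap = 0 := by
    rw [← map_smul, ← e2, e5, map_sub, ← e3, e4, sub_self]
  exact (smul_eq_zero.1 e6).resolve_left hd

lemma aux_spec {ι S R : Type} [Fintype ι] [CommRing S] [CommRing R] [Algebra S R] [Algebra ℂ S] [Algebra ℂ R]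
    [IsScalarTower ℂ S R] (b : Basis ι S R) (φ : S →ₐ[ℂ] ℂ) (I : Ideal R)
    (hI : I = Ideal.map (algebraMap S R) (RingHom.ker φ)) :
    ∃ _ : Basis ι ℂ (R ⧸ I), ∀ (s : R →ₗ[S] R) (t : (R ⧸ I) →ₗ[ℂ] (R ⧸ I)),
      (∀ r, t (Ideal.Quotient.mk I r) = Ideal.Quotient.mk I (s r)) →
      LinearMap.trace ℂ _ t = φ (LinearMap.trace S R s) := by
  classical
  let L : R →ₗ[ℂ] (ι → ℂ) :=
    { toFun := fun r i => φ (b.repr r i)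
      map_add' := fun r r' => by ext i; simp
      map_smul' := fun c r => by
        ext i
        rw [← algebraMap_smul S c r, map_smul, Finsupp.smul_apply, smul_eq_mul, map_mul, φ.commutes]
        rfl }
  have hLs : ∀ (c : S) r, L (c • r) = φ c • L r := fun c r => by
    ext i
    simp [L]
  have hLb : ∀ i, L (b i) = Pi.single i 1 := fun i => by
    ext j
    simp only [L, LinearMap.coe_mk, AddHom.coe_mk, Basis.repr_self, Finsupp.single_apply, Pi.single_apply]
    by_cases h : i = j <;> simp [h, eq_comm]
  have hLI : ∀ r ∈ I, L r = 0 := by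
    intro r hr
    have hr' : r ∈ (RingHom.ker φ) • (⊤ : Submodule S R) := by
      rw [Ideal.smul_top_eq_map, ← hI]
      exact hr
    refine Submodule.smul_induction_on hr' (fun c hc x _ => ?_) (fun x y hx hy => ?_)
    · rw [hLs, (RingHom.mem_ker).1 hc, zero_smul]
    · rw [map_add, hx, hy, add_zero]
  have hIL : ∀ r, L r = 0 → r ∈ I := by
    intro r hr
    rw [← b.sum_repr r]
    refine sum_mem fun i _ => ?_
    rw [Algebra.smul_def]
    refine I.mul_mem_right _ ?_
    rw [hI]
    exact Ideal.mem_map_of_mem _ (RingHom.mem_ker.2 (congrFun hr i))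
  have hLsurj : Function.Surjective L := by
    intro v
    refine ⟨∑ i, algebraMap ℂ R (v i) * b i, ?_⟩
    simp only [← Algebra.smul_def, map_sum, map_smul, hLb]
    ext j
    simp [Finset.sum_apply, Pi.single_apply]
  let L' : (R ⧸ I) →ₗ[ℂ] (ι → ℂ) := (I.restrictScalars ℂ).liftQ L hLI
  have hL' : ∀ r, L' (Ideal.Quotient.mk I r) = L r := fun r => rfl
  have hbij : Function.Bijective L' := by
    constructor
    · rw [injective_iff_map_eq_zero]
      intro x
      obtain ⟨r, rfl⟩ := Ideal.Quotient.mk_surjective x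
      intro h
      rw [hL'] at h
      exact Ideal.Quotient.eq_zero_iff_mem.2 (hIL r h)
    · intro v
      obtain ⟨r, rfl⟩ := hLsurj v
      exact ⟨_, hL' r⟩
  let B : Basis ι ℂ (R ⧸ I) := Basis.ofEquivFun (LinearEquiv.ofBijective L' hbij)
  have hBr : ∀ x i, B.repr x i = L' x i := fun x i => rfl
  have hB : ∀ i, B i = Ideal.Quotient.mk I (b i) := by
    intro i
    apply hbij.1
    rw [hL', hLb]
    ext j
    rw [← hBr, Basis.repr_self, Finsupp.single_eq_pi_single]
  refine ⟨B, fun s t hst => ?_⟩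
  rw [LinearMap.trace_eq_matrix_trace ℂ B, LinearMap.trace_eq_matrix_trace S b, Matrix.trace,
    Matrix.trace, map_sum]
  refine Finset.sum_congr rfl fun i _ => ?_
  rw [Matrix.diag_apply, Matrix.diag_apply, LinearMap.toMatrix_apply, LinearMap.toMatrix_apply,
    hB, hst, hBr, hL']
  rfl

lemma aux_ideal (n : ℕ) (a : Fin n → ℂ) : ∃ φ : SymSub n →ₐ[ℂ] ℂ,
    Ideal.span (Set.range fun s : Fin n =>
            MvPolynomial.esymm (Fin n) ℂ ((s : ℕ) + 1) - MvPolynomial.C (a s)) =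
      Ideal.map (algebraMap (SymSub n) (MvPolynomial (Fin n) ℂ)) (RingHom.ker φ) := by
  let E := esymmAlgEquiv (R := ℂ) (Fin n) (Fintype.card_fin n)
  refine ⟨(aeval a).comp E.symm.toAlgHom, ?_⟩
  have hEX : ∀ s : Fin n, E (X s) = ⟨esymm (Fin n) ℂ (s + 1), esymm_isSymmetric _ _ _⟩ := by
    intro s
    rw [← esymmAlgEquiv_symm_apply (R := ℂ) (σ := Fin n) (Fintype.card_fin n) s]
    exact E.apply_symm_apply _
  apply le_antisymm
  · rw [Ideal.span_le]
    rintro _ ⟨s, rfl⟩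
    have : (E (X s - C (a s))) ∈ RingHom.ker ((aeval a).comp E.symm.toAlgHom : SymSub n →ₐ[ℂ] ℂ) := by
      rw [RingHom.mem_ker]
      change aeval a (E.symm (E (X s - C (a s)))) = 0
      rw [E.symm_apply_apply]
      simp
    have h2 := Ideal.mem_map_of_mem (algebraMap (SymSub n) (MvPolynomial (Fin n) ℂ)) this
    have h3 : algebraMap (SymSub n) (MvPolynomial (Fin n) ℂ) (E (X s - C (a s))) =
        esymm (Fin n) ℂ ((s : ℕ) + 1) - C (a s) := by
      rw [map_sub, map_sub, hEX]
      congr 1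
      have : (C (a s) : MvPolynomial (Fin n) ℂ) = algebraMap ℂ _ (a s) := rfl
      rw [this, E.commutes]
      rfl
    rw [h3] at h2
    exact h2
  · rw [Ideal.map_le_iff_le_comap]
    intro c hc
    obtain ⟨q, rfl⟩ := E.surjective c
    have hq : aeval a q = (0 : ℂ) := by
      rw [RingHom.mem_ker] at hc
      change aeval a (E.symm (E q)) = 0 at hc
      rwa [E.symm_apply_apply] at hc
    rw [Ideal.mem_comap, ← Ideal.Quotient.eq_zero_iff_mem]
    set I := Ideal.span (Set.range fun s : Fin n =>
            MvPolynomial.esymm (Fin n) ℂ ((s : ℕ) + 1) - MvPolynomial.C (a s))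
    have key : ((Ideal.Quotient.mkₐ ℂ I).comp ((SymSub n).val.comp E.toAlgHom)) =
        (Algebra.ofId ℂ (MvPolynomial (Fin n) ℂ ⧸ I)).comp (aeval a) := by
      apply MvPolynomial.algHom_ext
      intro s
      change Ideal.Quotient.mk I ((E (X s) : SymSub n) : MvPolynomial (Fin n) ℂ) =
        algebraMap ℂ (MvPolynomial (Fin n) ℂ ⧸ I) (aeval a (X s))
      rw [hEX, aeval_X]
      change _ = Ideal.Quotient.mk I (C (a s))
      rw [Ideal.Quotient.eq]
      exact Ideal.subset_span ⟨s, rfl⟩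
    have := AlgHom.congr_fun key q
    change Ideal.Quotient.mk I ((E q : SymSub n) : MvPolynomial (Fin n) ℂ) =
        algebraMap ℂ (MvPolynomial (Fin n) ℂ ⧸ I) (aeval a q) at this
    rw [hq, map_zero] at this
    exact this

noncomputable def renS {n : ℕ} (σ : Equiv.Perm (Fin n)) :
    MvPolynomial (Fin n) ℂ →ₐ[SymSub n] MvPolynomial (Fin n) ℂ :=
  { (rename σ : MvPolynomial (Fin n) ℂ →ₐ[ℂ] MvPolynomial (Fin n) ℂ).toRingHom with
    commutes' := fun c => c.2 σ }

lemma aux_tr {n : ℕ} [Module.Finite (SymSub n) (MvPolynomial (Fin n) ℂ)]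
    [Module.Free (SymSub n) (MvPolynomial (Fin n) ℂ)]
    (σ : Equiv.Perm (Fin n)) (hσ : σ ≠ 1) :
    LinearMap.trace (SymSub n) (MvPolynomial (Fin n) ℂ) (renS σ).toLinearMap = 0 := by
  classical
  obtain ⟨i, hi⟩ : ∃ i, σ i ≠ i := by
    by_contra! h
    exact hσ (Equiv.ext h)
  let u : MvPolynomial (Fin n) ℂ := X i - X (σ i)
  have hu : u ≠ 0 := sub_ne_zero.2 fun h => hi (X_injective h).symm
  let d : MvPolynomial (Fin n) ℂ := ∏ τ : Equiv.Perm (Fin n), rename τ u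
  have hd : d.IsSymmetric := by
    intro τ
    simp only [d, map_prod, rename_rename]
    exact Equiv.prod_comp (Equiv.mulLeft τ) fun ρ : Equiv.Perm (Fin n) => rename ρ u
  have hd0 : d ≠ 0 := Finset.prod_ne_zero_iff.2 fun τ _ =>
    (map_ne_zero_iff _ (rename_injective τ τ.injective)).2 hu
  refine aux_trace_zero (renS σ) (X i) (∏ τ ∈ Finset.univ.erase (1 : Equiv.Perm (Fin n)), rename τ u)
    ⟨d, hd⟩ (fun h => hd0 (congrArg Subtype.val h)) ?_
  have h1 : X i - renS σ (X i) = rename (1 : Equiv.Perm (Fin n)) u := by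
    change X i - rename σ (X i) = rename id u
    rw [rename_X, rename_id_apply]
  rw [h1]
  exact Finset.mul_prod_erase Finset.univ (fun τ : Equiv.Perm (Fin n) => rename τ u) (Finset.mem_univ 1)

/-- For any a = (a₁,…,aₙ) ∈ ℂⁿ, the quotient of ℂ[z₁,…,zₙ] by the ideal
generated by σ_s(z) − a_s (s = 1,…,n), with Sₙ permuting the variables, is isomorphic
as an Sₙ-representation to the regular representation ℂ[Sₙ] (the group algebra with
left multiplication action). -/
theorem stmt_1
    (n : ℕ) (hn : 1 ≤ n) (a : Fin n → ℂ) :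
    ∃ e : (MvPolynomial (Fin n) ℂ ⧸ Ideal.span (Set.range fun s : Fin n =>
            MvPolynomial.esymm (Fin n) ℂ ((s : ℕ) + 1) - MvPolynomial.C (a s)))
          ≃ₗ[ℂ] MonoidAlgebra ℂ (Equiv.Perm (Fin n)),
      ∀ (σ : Equiv.Perm (Fin n)) (p : MvPolynomial (Fin n) ℂ),
        e (Ideal.Quotient.mk _ (MvPolynomial.rename σ p)) =
          MonoidAlgebra.of ℂ (Equiv.Perm (Fin n)) σ * e (Ideal.Quotient.mk _ p) := by
  obtain ⟨φ, hφ⟩ := aux_ideal n a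
  obtain ⟨b⟩ := aux_basis n
  obtain ⟨B, hB⟩ := aux_spec b φ _ hφ
  have hI : ∀ σ : Equiv.Perm (Fin n), ∀ p ∈ Ideal.span (Set.range fun s : Fin n =>
            MvPolynomial.esymm (Fin n) ℂ ((s : ℕ) + 1) - MvPolynomial.C (a s)),
      rename σ p ∈ Ideal.span (Set.range fun s : Fin n =>
            MvPolynomial.esymm (Fin n) ℂ ((s : ℕ) + 1) - MvPolynomial.C (a s)) := by
    intro σ p hp
    rw [← Ideal.mem_comap (f := (rename σ : MvPolynomial (Fin n) ℂ →ₐ[ℂ] MvPolynomial (Fin n) ℂ))]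
    refine Ideal.span_le.2 ?_ hp
    rintro _ ⟨s, rfl⟩
    simp only [SetLike.mem_coe, Ideal.mem_comap, map_sub, rename_C]
    rw [esymm_isSymmetric (Fin n) ℂ _ σ]
    exact Ideal.subset_span ⟨s, rfl⟩
  set I := Ideal.span (Set.range fun s : Fin n =>
            MvPolynomial.esymm (Fin n) ℂ ((s : ℕ) + 1) - MvPolynomial.C (a s))
  let t : Equiv.Perm (Fin n) → ((MvPolynomial (Fin n) ℂ ⧸ I) →ₗ[ℂ] (MvPolynomial (Fin n) ℂ ⧸ I)) :=
    fun σ => (Ideal.quotientMapₐ I (rename σ) (hI σ)).toLinearMap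
  have ht : ∀ σ p, t σ (Ideal.Quotient.mk I p) = Ideal.Quotient.mk I (rename σ p) := fun _ _ => rfl
  let ρ : Representation ℂ (Equiv.Perm (Fin n)) (MvPolynomial (Fin n) ℂ ⧸ I) :=
    { toFun := t
      map_one' := by
        refine LinearMap.ext fun x => ?_
        obtain ⟨p, rfl⟩ := Ideal.Quotient.mk_surjective x
        rw [ht]
        exact congrArg _ (rename_id_apply p)
      map_mul' := fun σ τ => by
        refine LinearMap.ext fun x => ?_
        obtain ⟨p, rfl⟩ := Ideal.Quotient.mk_surjective x
        rw [Module.End.mul_apply, ht, ht, ht]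
        exact congrArg _ (rename_rename τ σ p).symm }
  have hfd : FiniteDimensional ℂ (MvPolynomial (Fin n) ℂ ⧸ I) := Module.Finite.of_basis B
  have hfr : finrank ℂ (MvPolynomial (Fin n) ℂ ⧸ I) = Fintype.card (Equiv.Perm (Fin n)) := by
    rw [finrank_eq_card_basis B, Fintype.card_perm, Fintype.card_fin, Fintype.card_fin]
  have hfin : Module.Finite (SymSub n) (MvPolynomial (Fin n) ℂ) := Module.Finite.of_basis b
  have hfree : Module.Free (SymSub n) (MvPolynomial (Fin n) ℂ) := Module.Free.of_basis b
  obtain ⟨e, he⟩ := aux_rep ρ hfr (fun σ hσ => by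
    rw [hB (renS σ).toLinearMap (ρ σ) (fun r => rfl), aux_tr σ hσ, map_zero])
  exact ⟨e, fun σ p => he σ (Ideal.Quotient.mk I p)⟩
end

section
/- Fix N, n ≥ 1, let V = ℂ^N, and for a = (a_1,…,a_n) ∈ ℂ^n let I_a ⊂ ℂ[z_1,…,z_n] be the ideal generated by σ_s(z) − a_s, s = 1,…,n, where σ_s is the s-th elementary symmetric polynomial. Let S_n act on V^{⊗n} ⊗ (ℂ[z_1,…,z_n]/I_a) by permuting the tensor factors of V^{⊗n} and the variables z_1,…,z_n simultaneously. Then for every a ∈ ℂ^n, the dimension over ℂ of the subspace of S_n-invariant vectors of V^{⊗n} ⊗ (ℂ[z_1,…,z_n]/I_a) equals N^n. -/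
open scoped TensorProduct

/-- The simultaneous action of a permutation σ on V^{⊗n} ⊗ Q : it permutes the tensor
factors of the tensor power (v₁⊗…⊗vₙ ↦ v_{σ⁻¹(1)}⊗…⊗v_{σ⁻¹(n)}) and acts on Q by the
given linear map ρσ (which, below, is the permutation of variables on the quotient of
the polynomial ring). -/
noncomputable def permTensorAct (N n : ℕ) (Q : Type) [AddCommGroup Q] [Module ℂ Q]
    (ρσ : Q →ₗ[ℂ] Q) (σ : Equiv.Perm (Fin n)) :
    ((⨂[ℂ] _i : Fin n, (Fin N → ℂ)) ⊗[ℂ] Q) →ₗ[ℂ]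
      ((⨂[ℂ] _i : Fin n, (Fin N → ℂ)) ⊗[ℂ] Q) :=
  TensorProduct.map
    ((PiTensorProduct.reindex ℂ (fun _ : Fin n => (Fin N → ℂ)) σ).toLinearMap) ρσ

namespace S2
open MvPolynomial

abbrev Lam (n : ℕ) := symmetricSubalgebra (Fin n) ℂ
abbrev PA (n : ℕ) := MvPolynomial (Fin n) ℂ

lemma divlift {R A : Type*} [CommRing R] [CommRing A] [Algebra R A]
    (inj : Function.Injective (algebraMap R A)) (f' h' : Polynomial R) (hm' : h'.Monic)
    (g : Polynomial A)
    (hf : f'.map (algebraMap R A) = h'.map (algebraMap R A) * g) (hg : g.Monic) :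
    ∃ g' : Polynomial R, g'.Monic ∧ g'.map (algebraMap R A) = g := by
  have key : (f' /ₘ h').map (algebraMap R A) = g := by
    rw [Polynomial.map_divByMonic _ hm', hf,
        Polynomial.mul_divByMonic_cancel_left _ (hm'.map _)]
  refine ⟨_, ?_, key⟩
  apply Polynomial.monic_of_injective inj
  rwa [key]

lemma step {R A : Type*} [CommRing R] [CommRing A] [Algebra R A]
    (g : Polynomial R) (hgm : g.Monic) (x : A) (hroot : Polynomial.aeval x g = 0)
    (p : Polynomial R) : ∃ c : ℕ → R,
      Polynomial.aeval x p = ∑ i ∈ Finset.range g.natDegree, algebraMap R A (c i) * x ^ i := by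
  by_cases h1 : g = 1
  · subst h1
    have : (1 : A) = 0 := by simpa using hroot
    exact ⟨0, eq_of_zero_eq_one this.symm _ _⟩
  refine ⟨(p %ₘ g).coeff, ?_⟩
  rw [← Polynomial.aeval_modByMonic_eq_self_of_root hroot,
      Polynomial.aeval_eq_sum_range' (Polynomial.natDegree_modByMonic_lt _ hgm h1)]
  simp only [Algebra.smul_def]

section gen
variable {R A : Type*} [CommRing R] [CommRing A] [Algebra R A] {n : ℕ} (z : Fin n → A)

variable (R) in
def W (k : ℕ) : Submodule R A :=
  Submodule.span R {y | ∃ e : Fin n → ℕ, (∀ j, e j < n - (j : ℕ)) ∧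
    (∀ j : Fin n, k ≤ (j : ℕ) → e j = 0) ∧ y = ∏ j, (z j) ^ e j}

variable (R) in
def B (k : ℕ) : Subalgebra R A :=
  Algebra.adjoin R {y | ∃ j : Fin n, (j : ℕ) < k ∧ y = z j}

lemma g_lift [Nontrivial A] (k : ℕ)
    (f' : Polynomial R) (hf : f'.map (algebraMap R A) = ∏ j : Fin n, (Polynomial.X - Polynomial.C (z j))) : ∃ g' : Polynomial (B R z k), g'.Monic ∧
    g'.map (algebraMap (B R z k) A) = ∏ j ∈ Finset.univ.filter (fun j : Fin n => ¬ ((j : ℕ) < k)),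
      (Polynomial.X - Polynomial.C (z j : A)) := by
  set h : Polynomial A := ∏ j ∈ Finset.univ.filter (fun j : Fin n => ((j : ℕ) < k)),
      (Polynomial.X - Polynomial.C (z j : A)) with hh
  have hm : h.Monic := Polynomial.monic_prod_of_monic _ _ fun j _ => Polynomial.monic_X_sub_C _
  have hl : h ∈ Polynomial.lifts (algebraMap (B R z k) A) := by
    apply prod_mem
    intro j hj
    refine (Polynomial.mem_lifts _).2 ⟨Polynomial.X - Polynomial.C
      (⟨z j, Algebra.subset_adjoin ⟨j, by simpa using hj, rfl⟩⟩ : B R z k), ?_⟩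
    rw [Polynomial.map_sub, Polynomial.map_X, Polynomial.map_C]
    rfl
  obtain ⟨h', hh', -, hm'⟩ := Polynomial.lifts_and_degree_eq_and_monic hl hm
  exact divlift (R := B R z k) (A := A) Subtype.val_injective (f'.map (algebraMap R (B R z k))) h' hm' _ (by
    rw [hh', Polynomial.map_map,
      ← IsScalarTower.algebraMap_eq, hf, ← Finset.prod_filter_mul_prod_filter_not
        Finset.univ (fun j : Fin n => (j : ℕ) < k)])
    (Polynomial.monic_prod_of_monic _ _ fun j _ => Polynomial.monic_X_sub_C _)

lemma W_mul (k : ℕ) (hk : k < n) (i : ℕ) (hi : i < n - k) (y : A) (hy : y ∈ W R z k) :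
    y * (z ⟨k, hk⟩) ^ i ∈ W R z (k + 1) := by
  induction hy using Submodule.span_induction with
  | mem y h =>
    obtain ⟨e, h1, h2, rfl⟩ := h
    apply Submodule.subset_span
    refine ⟨Function.update e ⟨k, hk⟩ i, ?_, ?_, ?_⟩
    · intro j
      by_cases hj : j = ⟨k, hk⟩
      · subst hj; simpa using hi
      · simpa [Function.update_of_ne hj] using h1 j
    · intro j hj
      have : j ≠ ⟨k, hk⟩ := by rintro rfl; simp at hj
      rw [Function.update_of_ne this]
      exact h2 j (by omega)
    · rw [← Finset.mul_prod_erase _ _ (Finset.mem_univ (⟨k, hk⟩ : Fin n)),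
        ← Finset.mul_prod_erase _ (fun j => z j ^ (Function.update e ⟨k, hk⟩ i j)) (Finset.mem_univ (⟨k, hk⟩ : Fin n))]
      rw [h2 _ le_rfl]
      simp only [Function.update_self, pow_zero, one_mul]
      rw [mul_comm]
      congr 1
      apply Finset.prod_congr rfl
      intro j hj
      rw [Function.update_of_ne (Finset.ne_of_mem_erase hj)]
  | zero => simp
  | add x y _ _ hx hy => rw [add_mul]; exact add_mem hx hy
  | smul c x _ hx => rw [smul_mul_assoc]; exact Submodule.smul_mem _ _ hx

lemma B_le [Nontrivial A] (f' : Polynomial R) (hf : f'.map (algebraMap R A) = ∏ j : Fin n, (Polynomial.X - Polynomial.C (z j)))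
    (k : ℕ) (hk : k ≤ n) (y : A) (hy : y ∈ B R z k) : y ∈ W R z k := by
  induction k generalizing y with
  | zero =>
    have : B R z 0 = ⊥ := by simp [B]
    rw [this] at hy
    obtain ⟨c, rfl⟩ := Algebra.mem_bot.1 hy
    rw [Algebra.algebraMap_eq_smul_one]
    apply Submodule.smul_mem
    apply Submodule.subset_span
    exact ⟨fun _ => 0, fun j => Nat.sub_pos_of_lt j.2, fun _ _ => rfl, by simp⟩
  | succ k ih =>
    have hk' : k < n := hk
    set x : A := z ⟨k, hk'⟩ with hx
    have hS : {y | ∃ j : Fin n, (j : ℕ) < k + 1 ∧ y = (z j : A)} =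
        {y | ∃ j : Fin n, (j : ℕ) < k ∧ y = (z j : A)} ∪ {x} := by
      ext z
      constructor
      · rintro ⟨j, hj, rfl⟩
        rcases Nat.lt_succ_iff_lt_or_eq.1 hj with h | h
        · exact Or.inl ⟨j, h, rfl⟩
        · right; simp only [Set.mem_singleton_iff, hx]; congr; exact Fin.ext h
      · rintro (⟨j, hj, rfl⟩ | rfl)
        · exact ⟨j, by omega, rfl⟩
        · exact ⟨_, by simp, hx⟩
    rw [B, hS, Algebra.adjoin_union_eq_adjoin_adjoin] at hy
    have hy2 : y ∈ Algebra.adjoin (B R z k) {x} := hy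
    rw [Algebra.adjoin_singleton_eq_range_aeval] at hy2
    obtain ⟨p, rfl⟩ := hy2
    obtain ⟨g, hgm, hg⟩ := g_lift z k f' hf
    have hroot : Polynomial.aeval x g = 0 := by
      rw [← Polynomial.eval_map_algebraMap, hg, Polynomial.eval_prod]
      apply Finset.prod_eq_zero (i := ⟨k, hk'⟩) (by simp)
      simp [hx]
    have hdeg : g.natDegree = n - k := by
      rw [← hgm.natDegree_map (algebraMap (B R z k) A), hg,
        Polynomial.natDegree_prod_of_monic _ _ fun j _ => Polynomial.monic_X_sub_C _]
      simp only [Polynomial.natDegree_X_sub_C, Finset.sum_const, smul_eq_mul, mul_one]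
      rw [Finset.filter_not, Finset.card_sdiff_of_subset (Finset.filter_subset _ _)]
      simp [Fin.card_filter_val_lt, hk'.le]
    change Polynomial.aeval x p ∈ _
    obtain ⟨c, hc⟩ := step (R := B R z k) (A := A) g hgm x hroot p
    rw [hc, hdeg]
    apply sum_mem
    intro i hi
    exact W_mul z k hk' i (Finset.mem_range.1 hi) _ (ih hk'.le _ (c i).2)

lemma W_top [Nontrivial A] (f' : Polynomial R) (hf : f'.map (algebraMap R A) = ∏ j : Fin n, (Polynomial.X - Polynomial.C (z j)))
    (hz : Algebra.adjoin R (Set.range z) = ⊤) : W R z n = ⊤ := by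
  rw [eq_top_iff]
  intro y hy0
  apply B_le z f' hf n le_rfl
  have : B R z n = ⊤ := by
    rw [← hz, B]
    congr 1
    ext y
    constructor
    · rintro ⟨j, -, rfl⟩; exact ⟨j, rfl⟩
    · rintro ⟨j, rfl⟩; exact ⟨j, j.2, rfl⟩
  rw [this]; trivial

end gen

lemma f_lift (n : ℕ) : ∃ f' : Polynomial (Lam n),
    f'.map (algebraMap (Lam n) (PA n)) = ∏ j : Fin n, (Polynomial.X - Polynomial.C (X j : PA n)) := by
  have : (∏ j : Fin n, (Polynomial.X - Polynomial.C (X j : PA n))) ∈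
      Polynomial.lifts (algebraMap (Lam n) (PA n)) := by
    rw [Polynomial.lifts_iff_coeff_lifts]
    intro m
    refine ⟨⟨(∏ j : Fin n, (Polynomial.X - Polynomial.C (X j : PA n))).coeff m, ?_⟩, rfl⟩
    rw [mem_symmetricSubalgebra]
    intro σ
    have h : (∏ j : Fin n, (Polynomial.X - Polynomial.C (X j : PA n))).map
        ((rename σ : PA n →ₐ[ℂ] PA n) : PA n →+* PA n) =
        ∏ j : Fin n, (Polynomial.X - Polynomial.C (X j : PA n)) := by
      rw [Polynomial.map_prod]
      simp only [Polynomial.map_sub, Polynomial.map_X, Polynomial.map_C, RingHom.coe_coe, rename_X]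
      exact Equiv.prod_comp σ (fun j => Polynomial.X - Polynomial.C (X j : PA n))
    conv_rhs => rw [← h]
    rw [Polynomial.coeff_map]; rfl
  exact (Polynomial.mem_lifts _).1 this

abbrev Idx (n : ℕ) := (j : Fin n) → Fin (n - (j : ℕ))

noncomputable def mon (n : ℕ) (e : Idx n) : PA n := ∏ j, X j ^ (e j : ℕ)

lemma mon_span (n : ℕ) : Submodule.span (Lam n) (Set.range (mon n)) = ⊤ := by
  obtain ⟨f', hf⟩ := f_lift n
  have htop : Algebra.adjoin (Lam n) (Set.range (X : Fin n → PA n)) = ⊤ := by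
    rw [eq_top_iff]
    intro y hy0
    clear hy0
    induction y using MvPolynomial.induction_on with
    | C a => exact Subalgebra.algebraMap_mem _ (algebraMap ℂ (Lam n) a)
    | add p q hp hq => exact add_mem hp hq
    | mul_X p i hp => exact mul_mem hp (Algebra.subset_adjoin ⟨i, rfl⟩)
  rw [eq_top_iff, ← W_top (X : Fin n → PA n) f' hf htop]
  apply Submodule.span_mono
  rintro _ ⟨e, h, -, rfl⟩
  exact ⟨fun j => ⟨e j, h j⟩, rfl⟩

lemma card_Idx (n : ℕ) : Fintype.card (Idx n) = n.factorial := by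
  rw [Fintype.card_pi]
  simp only [Fintype.card_fin]
  rw [Fin.prod_univ_eq_prod_range (fun i => n - i) n, ← Nat.descFactorial_eq_prod_range,
    Nat.descFactorial_self]

/-- the action of a permutation, as a Λ-linear map -/
noncomputable def act (n : ℕ) (σ : Equiv.Perm (Fin n)) : PA n →ₗ[Lam n] PA n where
  toFun p := rename σ p
  map_add' := by simp
  map_smul' c p := by
    simp only [Algebra.smul_def, map_mul, RingHom.id_apply]
    congr 1
    exact c.2 σ

lemma mon_li (n : ℕ) : LinearIndependent (Lam n) (mon n) := by
  classical
  have hc : Fintype.card (Equiv.Perm (Fin n)) = Fintype.card (Idx n) := by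
    rw [card_Idx, Fintype.card_perm, Fintype.card_fin]
  let q : Equiv.Perm (Fin n) ≃ Idx n := Fintype.equivOfCardEq hc
  let M : Matrix (Idx n) (Idx n) (PA n) := fun i j => rename (q.symm i) (mon n j)
  have hdet : M.det ≠ 0 := by
    intro h0
    obtain ⟨v, hv, hM⟩ := Matrix.exists_vecMul_eq_zero_iff.2 h0
    apply hv
    have hli := (linearIndependent_monoidHom (PA n) (PA n)).comp
      (fun i : Idx n => ((rename (q.symm i) : PA n →ₐ[ℂ] PA n) : PA n →* PA n)) (by
        intro i j hij
        apply q.symm.injective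
        ext m
        have := DFunLike.congr_fun hij (X m)
        simp only [MonoidHom.coe_coe, rename_X] at this
        exact congrArg Fin.val (X_injective this))
    rw [Fintype.linearIndependent_iff] at hli
    funext i
    apply hli v
    let T : PA n →ₗ[Lam n] PA n := ∑ i, v i • act n (q.symm i)
    have hT : T = 0 := by
      apply LinearMap.ext_on_range (mon_span n)
      intro j
      have := congrFun hM j
      simpa [T, Matrix.vecMul, dotProduct, M, act] using this
    funext x
    have := LinearMap.congr_fun hT x
    simpa [T, act] using this
  rw [Fintype.linearIndependent_iff]
  intro c hc0
  have hmv : M.mulVec (fun j => (c j : PA n)) = 0 := by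
    funext i
    have := congrArg (act n (q.symm i)) hc0
    rw [map_sum, map_zero] at this
    simp only [map_smul] at this
    rw [Pi.zero_apply, ← this]
    simp only [Matrix.mulVec, dotProduct, M, act, Algebra.smul_def]
    apply Finset.sum_congr rfl
    intro j _
    rw [mul_comm]; rfl
  have := Matrix.eq_zero_of_mulVec_eq_zero hdet hmv
  intro i
  exact Subtype.ext (congrFun this i)

noncomputable def bas (n : ℕ) : Module.Basis (Idx n) (Lam n) (PA n) :=
  Module.Basis.mk (mon_li n) (mon_span n).ge

lemma trace_act (n : ℕ) (σ : Equiv.Perm (Fin n)) (hσ : σ ≠ 1) :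
    LinearMap.trace (Lam n) (PA n) (act n σ) = 0 := by
  classical
  obtain ⟨i, hi⟩ : ∃ i, σ i ≠ i := by
    by_contra! h; exact hσ (Equiv.ext h)
  let d : PA n := X (σ i) - X i
  have hd : d ≠ 0 := sub_ne_zero.2 fun h => hi (X_injective h)
  let D : PA n := ∏ τ : Equiv.Perm (Fin n), rename τ d
  have hD : D ≠ 0 := Finset.prod_ne_zero_iff.2 fun τ _ h =>
    hd (rename_injective τ τ.injective (by rw [h, map_zero]))
  have hDs : D ∈ Lam n := by
    rw [mem_symmetricSubalgebra]
    intro σ'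
    simp only [D, map_prod, rename_rename]
    exact (Equiv.prod_comp (Equiv.mulLeft σ') (fun τ => rename τ d))
  obtain ⟨D', hD'⟩ : ∃ D', D = d * D' := by
    refine ⟨∏ τ ∈ Finset.univ.erase (1 : Equiv.Perm (Fin n)), rename τ d, ?_⟩
    simp only [D]
    rw [← Finset.mul_prod_erase _ _ (Finset.mem_univ (1 : Equiv.Perm (Fin n)))]
    simp
  let μ : PA n → (PA n →ₗ[Lam n] PA n) := fun x => LinearMap.mulLeft (Lam n) x
  have key : LinearMap.trace (Lam n) (PA n) (μ D * act n σ) = 0 := by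
    have e2 : (μ D' * act n σ) * μ (X i) = μ (X (σ i)) * (μ D' * act n σ) := by
      refine LinearMap.ext fun x => ?_
      simp [μ, act]
      ring
    have e3 : μ D * act n σ = μ (X (σ i)) * (μ D' * act n σ) - μ (X i) * (μ D' * act n σ) := by
      refine LinearMap.ext fun x => ?_
      simp [μ, hD', d]
      ring
    rw [e3, map_sub, ← e2, LinearMap.trace_mul_comm, sub_self]
  have e4 : μ D * act n σ = (⟨D, hDs⟩ : Lam n) • act n σ := by
    refine LinearMap.ext fun x => ?_
    rfl
  rw [e4, LinearMap.map_smul, smul_eq_mul] at key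
  rcases mul_eq_zero.1 key with h | h
  · exact absurd (congrArg Subtype.val h) hD
  · exact h

noncomputable def ev (n : ℕ) (a : Fin n → ℂ) : Lam n →ₐ[ℂ] ℂ :=
  (aeval a).comp (esymmAlgEquiv (Fin n) ℂ (Fintype.card_fin n)).symm.toAlgHom

noncomputable abbrev Ia (n : ℕ) (a : Fin n → ℂ) : Ideal (PA n) :=
  Ideal.span (Set.range fun s : Fin n =>
          MvPolynomial.esymm (Fin n) ℂ ((s : ℕ) + 1) - MvPolynomial.C (a s))

lemma mk_aux (n : ℕ) (a : Fin n → ℂ) (q : PA n) :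
    Ideal.Quotient.mk (Ia n a) (aeval (fun i : Fin n => esymm (Fin n) ℂ (i + 1)) q) =
      Ideal.Quotient.mk (Ia n a) (C (aeval a q)) := by
  induction q using MvPolynomial.induction_on with
  | C r => simp [MvPolynomial.algebraMap_eq]
  | add p q hp hq =>
    simp only [map_add]
    rw [hp, hq]
  | mul_X p i hp =>
    simp only [map_mul, aeval_X]
    rw [hp]
    congr 1
    rw [Ideal.Quotient.mk_eq_mk_iff_sub_mem]
    exact Ideal.subset_span ⟨i, rfl⟩

lemma mk_lam (n : ℕ) (a : Fin n → ℂ) (c : Lam n) :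
    Ideal.Quotient.mk (Ia n a) (c : PA n) = Ideal.Quotient.mk (Ia n a) (C (ev n a c)) := by
  obtain ⟨q, rfl⟩ := (esymmAlgEquiv (Fin n) ℂ (Fintype.card_fin n)).surjective c
  have h1 : ev n a (esymmAlgEquiv (Fin n) ℂ (Fintype.card_fin n) q) = aeval a q :=
    congrArg (aeval a) (AlgEquiv.symm_apply_apply (esymmAlgEquiv (Fin n) ℂ (Fintype.card_fin n)) q)
  have h2 : ((esymmAlgEquiv (Fin n) ℂ (Fintype.card_fin n) q : Lam n) : PA n) =
    aeval (fun i : Fin n => esymm (Fin n) ℂ (i + 1)) q := esymmAlgHom_apply _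
  rw [h1, h2]
  exact mk_aux n a q

lemma ev_esymm (n : ℕ) (a : Fin n → ℂ) (s : Fin n) :
    ev n a ⟨esymm (Fin n) ℂ (s + 1), esymm_isSymmetric _ _ _⟩ = a s := by
  have := esymmAlgEquiv_symm_apply (σ := Fin n) (R := ℂ) (Fintype.card_fin n) s
  have h2 := congrArg (aeval a) this
  rw [aeval_X] at h2
  exact h2

noncomputable def Phi (n : ℕ) (a : Fin n → ℂ) : PA n →ₗ[ℂ] (Idx n → ℂ) where
  toFun x i := ev n a ((bas n).repr x i)
  map_add' x y := by funext i; simp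
  map_smul' c x := by
    funext i
    have : c • x = (algebraMap ℂ (Lam n) c) • x := by rw [algebraMap_smul]
    rw [this, LinearEquiv.map_smul]
    simp

lemma Phi_smul (n : ℕ) (a : Fin n → ℂ) (c : Lam n) (x : PA n) (i : Idx n) :
    Phi n a ((c : PA n) * x) i = ev n a c * Phi n a x i := by
  have : (c : PA n) * x = c • x := rfl
  change ev n a ((bas n).repr _ i) = ev n a c * ev n a ((bas n).repr _ i)
  rw [this, LinearEquiv.map_smul, Finsupp.smul_apply, smul_eq_mul, map_mul]

lemma Phi_Ia (n : ℕ) (a : Fin n → ℂ) (x : PA n) (hx : x ∈ Ia n a) : ∀ y, Phi n a (y * x) = 0 := by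
  induction hx using Submodule.span_induction with
  | mem x h =>
    obtain ⟨s, rfl⟩ := h
    intro y
    have := Phi_smul n a (⟨esymm (Fin n) ℂ (s + 1), esymm_isSymmetric _ _ _⟩ - algebraMap ℂ (Lam n) (a s)) y
    rw [map_sub, ev_esymm, AlgHom.commutes, Algebra.algebraMap_self_apply, sub_self] at this
    funext i
    have h2 := this i
    rw [zero_mul, mul_comm] at h2
    exact h2
  | zero => simp
  | add x y _ _ hx hy => intro z; rw [mul_add, map_add, hx, hy, add_zero]
  | smul c x _ hx => intro y; rw [smul_eq_mul, ← mul_assoc]; exact hx _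

noncomputable def PhiQ (n : ℕ) (a : Fin n → ℂ) : (PA n ⧸ Ia n a) →ₗ[ℂ] (Idx n → ℂ) :=
  (Submodule.liftQ ((Ia n a).restrictScalars ℂ) (Phi n a) (by
    intro x hx
    have := Phi_Ia n a x hx 1
    rwa [one_mul] at this)) ∘ₗ
    (Submodule.Quotient.restrictScalarsEquiv ℂ (Ia n a)).symm.toLinearMap

lemma PhiQ_mk (n : ℕ) (a : Fin n → ℂ) (p : PA n) :
    PhiQ n a (Ideal.Quotient.mk (Ia n a) p) = Phi n a p := rfl

lemma Phi_bas (n : ℕ) (a : Fin n → ℂ) (i j : Idx n) :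
    Phi n a (bas n i) j = if i = j then 1 else 0 := by
  change ev n a ((bas n).repr _ j) = _
  rw [Module.Basis.repr_self, Finsupp.single_apply]
  split_ifs <;> simp

lemma mk_eq (n : ℕ) (a : Fin n → ℂ) (p : PA n) :
    Ideal.Quotient.mk (Ia n a) p = ∑ i, Phi n a p i • Ideal.Quotient.mk (Ia n a) (bas n i) := by
  conv_lhs => rw [← (bas n).sum_repr p, map_sum]
  apply Finset.sum_congr rfl
  intro i _
  have : (bas n).repr p i • bas n i = ((bas n).repr p i : PA n) * bas n i := rfl
  rw [this, map_mul, mk_lam, ← map_mul, ← MvPolynomial.smul_eq_C_mul]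
  rfl

noncomputable def basQ (n : ℕ) (a : Fin n → ℂ) : Module.Basis (Idx n) ℂ (PA n ⧸ Ia n a) :=
  Module.Basis.mk (v := fun i => Ideal.Quotient.mk (Ia n a) (bas n i)) (by
    rw [Fintype.linearIndependent_iff]
    intro g hg i
    have := congrFun (congrArg (PhiQ n a) hg) i
    rw [map_sum, map_zero] at this
    simp only [map_smul, PhiQ_mk, Finset.sum_apply, Pi.smul_apply, Phi_bas, Pi.zero_apply] at this
    simpa using this) (by
    intro x _
    obtain ⟨p, rfl⟩ := Ideal.Quotient.mk_surjective x
    rw [mk_eq]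
    exact sum_mem fun i _ => Submodule.smul_mem _ _ (Submodule.subset_span ⟨i, rfl⟩))

lemma basQ_apply (n : ℕ) (a : Fin n → ℂ) (i : Idx n) :
    basQ n a i = Ideal.Quotient.mk (Ia n a) (bas n i) := by simp [basQ]

lemma basQ_repr (n : ℕ) (a : Fin n → ℂ) (p : PA n) (i : Idx n) :
    (basQ n a).repr (Ideal.Quotient.mk (Ia n a) p) i = Phi n a p i := by
  rw [mk_eq]
  simp only [← basQ_apply]
  rw [Module.Basis.repr_sum_self]

lemma trace_Q (n : ℕ) (a : Fin n → ℂ) (σ : Equiv.Perm (Fin n)) (hσ : σ ≠ 1)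
    (r : (PA n ⧸ Ia n a) →ₗ[ℂ] (PA n ⧸ Ia n a))
    (hr : ∀ p : PA n, r (Ideal.Quotient.mk _ p) = Ideal.Quotient.mk _ (rename σ p)) :
    LinearMap.trace ℂ _ r = 0 := by
  classical
  have h := congrArg (ev n a) (trace_act n σ hσ)
  rw [LinearMap.trace_eq_matrix_trace _ (bas n), Matrix.trace, map_sum, map_zero] at h
  rw [LinearMap.trace_eq_matrix_trace ℂ (basQ n a), Matrix.trace, ← h]
  apply Finset.sum_congr rfl
  intro i _
  rw [Matrix.diag_apply, Matrix.diag_apply, LinearMap.toMatrix_apply, LinearMap.toMatrix_apply,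
    basQ_apply, hr, basQ_repr]
  rfl

lemma finrank_Q (n : ℕ) (a : Fin n → ℂ) : Module.finrank ℂ (PA n ⧸ Ia n a) = n.factorial := by
  rw [Module.finrank_eq_card_basis (basQ n a), card_Idx]

lemma finrank_inv {G V : Type*} [Group G] [Fintype G] [AddCommGroup V] [Module ℂ V]
    [FiniteDimensional ℂ V] (ρ : Representation ℂ G V) (d : ℕ)
    (h : ∑ g : G, LinearMap.trace ℂ V (ρ g) = (Fintype.card G : ℂ) * d) :
    Module.finrank ℂ ρ.invariants = d := by
  have hne : (Fintype.card G : ℂ) ≠ 0 := by exact_mod_cast Fintype.card_ne_zero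
  have : Invertible (Fintype.card G : ℂ) := invertibleOfNonzero hne
  have h1 := (Representation.isProj_averageMap ρ).trace
  have h2 : LinearMap.trace ℂ V ρ.averageMap =
      (Fintype.card G : ℂ)⁻¹ * ∑ g : G, LinearMap.trace ℂ V (ρ g) := by
    simp [GroupAlgebra.average, map_sum]
  rw [h2, h, ← mul_assoc, inv_mul_cancel₀ hne, one_mul] at h1
  exact_mod_cast h1.symm

lemma rank_inv {G V : Type} [Group G] [Fintype G] [AddCommGroup V] [Module ℂ V]
    [FiniteDimensional ℂ V] (φ : G → V →ₗ[ℂ] V) (h1 : φ 1 = 1)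
    (h2 : ∀ σ τ, φ (σ * τ) = φ σ * φ τ) (d : ℕ)
    (h : ∑ g : G, LinearMap.trace ℂ V (φ g) = (Fintype.card G : ℂ) * d) :
    Module.rank ℂ ↥(⨅ σ : G, LinearMap.eqLocus (φ σ) LinearMap.id) = d := by
  let R : Representation ℂ G V := { toFun := φ, map_one' := h1, map_mul' := h2 }
  have hinv : (⨅ σ : G, LinearMap.eqLocus (φ σ) LinearMap.id) = R.invariants := by
    ext x
    rw [Submodule.mem_iInf, Representation.mem_invariants]
    rfl
  rw [hinv, ← Module.finrank_eq_rank, finrank_inv R d h]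

end S2

theorem stmt_2
    (N n : ℕ) (hN : 1 ≤ N) (hn : 1 ≤ n) (a : Fin n → ℂ)
    (ρ : Equiv.Perm (Fin n) →
      (MvPolynomial (Fin n) ℂ ⧸ Ideal.span (Set.range fun s : Fin n =>
          MvPolynomial.esymm (Fin n) ℂ ((s : ℕ) + 1) - MvPolynomial.C (a s))) →ₗ[ℂ]
      (MvPolynomial (Fin n) ℂ ⧸ Ideal.span (Set.range fun s : Fin n =>
          MvPolynomial.esymm (Fin n) ℂ ((s : ℕ) + 1) - MvPolynomial.C (a s))))
    (hρ : ∀ (σ : Equiv.Perm (Fin n)) (p : MvPolynomial (Fin n) ℂ),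
      ρ σ (Ideal.Quotient.mk _ p) = Ideal.Quotient.mk _ (MvPolynomial.rename σ p)) :
    Module.rank ℂ
      ↥(⨅ σ : Equiv.Perm (Fin n),
        LinearMap.eqLocus (permTensorAct N n _ (ρ σ) σ) LinearMap.id) =
      (N : Cardinal) ^ n := by
  classical
  let bV := Basis.piTensorProduct (fun _ : Fin n => Pi.basisFun ℂ (Fin N))
  have : FiniteDimensional ℂ (⨂[ℂ] _i : Fin n, (Fin N → ℂ)) := Module.Basis.finiteDimensional_of_finite bV
  have : FiniteDimensional ℂ (S2.PA n ⧸ S2.Ia n a) :=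
    Module.Basis.finiteDimensional_of_finite (S2.basQ n a)
  have hone : ρ 1 = LinearMap.id := by
    refine LinearMap.ext fun x => ?_
    obtain ⟨p, rfl⟩ := Ideal.Quotient.mk_surjective x
    rw [hρ]; simp
  have hfd : FiniteDimensional ℂ
      ((⨂[ℂ] _i : Fin n, (Fin N → ℂ)) ⊗[ℂ] (S2.PA n ⧸ S2.Ia n a)) :=
    Module.Finite.tensorProduct ℂ _ _
  have key := S2.rank_inv (G := Equiv.Perm (Fin n))
    (V := (⨂[ℂ] _i : Fin n, (Fin N → ℂ)) ⊗[ℂ] (S2.PA n ⧸ S2.Ia n a))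
    (fun σ => permTensorAct N n _ (ρ σ) σ) (by
      have : (PiTensorProduct.reindex ℂ (fun _ : Fin n => (Fin N → ℂ))
          (1 : Equiv.Perm (Fin n))).toLinearMap = LinearMap.id := by
        ext x
        simp
        rfl
      rw [permTensorAct, hone, this, TensorProduct.map_id]
      rfl) (by
      intro σ τ
      have h1 : (PiTensorProduct.reindex ℂ (fun _ : Fin n => (Fin N → ℂ)) (σ * τ)).toLinearMap =
          (PiTensorProduct.reindex ℂ (fun _ : Fin n => (Fin N → ℂ)) σ).toLinearMap ∘ₗ
          (PiTensorProduct.reindex ℂ (fun _ : Fin n => (Fin N → ℂ)) τ).toLinearMap := by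
        ext x
        simp
        rfl
      have h2 : ρ (σ * τ) = ρ σ ∘ₗ ρ τ := by
        refine LinearMap.ext fun x => ?_
        obtain ⟨p, rfl⟩ := Ideal.Quotient.mk_surjective x
        rw [LinearMap.comp_apply, hρ, hρ, hρ, MvPolynomial.rename_rename]; rfl
      rw [permTensorAct, h1, h2, TensorProduct.map_comp]
      rfl) (N ^ n) (by
      rw [Finset.sum_eq_single (1 : Equiv.Perm (Fin n))]
      · have e : permTensorAct N n _ (ρ 1) 1 = TensorProduct.map
          (PiTensorProduct.reindex ℂ (fun _ : Fin n => (Fin N → ℂ))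
          (1 : Equiv.Perm (Fin n))).toLinearMap (ρ 1) := rfl
        have : (PiTensorProduct.reindex ℂ (fun _ : Fin n => (Fin N → ℂ))
            (1 : Equiv.Perm (Fin n))).toLinearMap = LinearMap.id := by
          ext x
          simp
          rfl
        have t1 := LinearMap.trace_tensorProduct' (R := ℂ)
          (LinearMap.id : (⨂[ℂ] _i : Fin n, (Fin N → ℂ)) →ₗ[ℂ] _)
          (LinearMap.id : (S2.PA n ⧸ S2.Ia n a) →ₗ[ℂ] _)
        rw [LinearMap.trace_id, LinearMap.trace_id, S2.finrank_Q,
          Module.finrank_eq_card_basis bV] at t1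
        rw [e, hone, this]
        refine t1.trans ?_
        simp [Fintype.card_perm, mul_comm]
      · intro σ _ hσ
        refine (LinearMap.trace_tensorProduct' (R := ℂ) _ (ρ σ)).trans ?_
        rw [S2.trace_Q n a σ hσ (ρ σ) (hρ σ), mul_zero]
      · simp)
  refine key.trans ?_
  simp
end

section
/- Let A be a finite-dimensional commutative unital local ℂ-algebra with maximal ideal 𝔪 such that A/𝔪 ≅ ℂ, equipped with a nondegenerate symmetric ℂ-bilinear form (·,·) satisfying (xy, z) = (x, yz) for all x, y, z ∈ A. Let 𝔪^⊥ = {a ∈ A : (a, m) = 0 for all m ∈ 𝔪} be the orthogonal complement of 𝔪. Then every nonzero ideal I ⊆ A contains 𝔪^⊥. -/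
/-- Let A be a finite-dimensional commutative unital local ℂ-algebra with
maximal ideal 𝔪 and residue field ℂ, equipped with a nondegenerate symmetric invariant
bilinear form.  Then every nonzero ideal of A contains the orthogonal complement 𝔪^⊥. -/
theorem stmt_6
    (A : Type) [CommRing A] [Algebra ℂ A] [FiniteDimensional ℂ A] [IsLocalRing A]
    (hres : Nonempty ((A ⧸ IsLocalRing.maximalIdeal A) ≃ₐ[ℂ] ℂ))
    (b : A →ₗ[ℂ] A →ₗ[ℂ] ℂ)
    (hsymm : ∀ x y : A, b x y = b y x)
    (hinv : ∀ x y z : A, b (x * y) z = b x (y * z))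
    (hnondeg : ∀ x : A, (∀ y : A, b x y = 0) → x = 0)
    (I : Ideal A) (hI : I ≠ ⊥) :
    ∀ a : A, (∀ m ∈ IsLocalRing.maximalIdeal A, b a m = 0) → a ∈ I := by
  intro a ha
  by_contra haI
  obtain ⟨f, hf, hfI⟩ := Submodule.exists_le_ker_of_notMem (p := I.restrictScalars ℂ) (v := a) haI
  have hinj : Function.Injective b := by
    rw [injective_iff_map_eq_zero]
    intro x hx
    exact hnondeg x (fun y => by rw [hx]; rfl)
  have hsurj : Function.Surjective b :=
    (LinearMap.injective_iff_surjective_of_finrank_eq_finrank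
      (Subspace.dual_finrank_eq (K := ℂ) (V := A)).symm).1 hinj
  obtain ⟨c, rfl⟩ := hsurj f
  have hc : IsUnit c := by
    by_contra h
    exact hf (by rw [hsymm]; exact ha c ((IsLocalRing.mem_maximalIdeal c).2 h))
  obtain ⟨d, hd⟩ := hc.exists_right_inv
  apply hI
  rw [Submodule.eq_bot_iff]
  intro x hx
  apply hnondeg
  intro y
  have h1 : d * (x * y) ∈ I := I.mul_mem_left _ (I.mul_mem_right _ hx)
  have h2 : b c (d * (x * y)) = 0 := hfI h1
  rw [← hinv, hd, ← hinv, one_mul] at h2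
  exact h2
end

section
/- Let A be a finite-dimensional commutative unital ℂ-algebra equipped with a nondegenerate symmetric ℂ-bilinear form (·,·) satisfying (xy, z) = (x, yz) for all x, y, z ∈ A, and let I ⊆ A be an ideal. The annihilator Ann I = {a ∈ A : aI = 0} is an ideal of A on which I acts by zero, so Ann I is a module over the quotient algebra A/I. Then the A/I-module Ann I is isomorphic to the coregular representation of A/I, i.e. to the dual space (A/I)^* with module structure (a·ξ)(b) = ξ(ab) for a, b ∈ A/I, ξ ∈ (A/I)^*. In particular, the image of A/I in End(Ann I) is a maximal commutative subalgebra. -/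
/-- The annihilator `Ann I = {a ∈ A : aI = 0}` of an ideal `I`, viewed as a ℂ-submodule
of `A`. -/
noncomputable def annSub (A : Type) [CommRing A] [Algebra ℂ A] (I : Ideal A) :
    Submodule ℂ A :=
  (Submodule.annihilator I).restrictScalars ℂ

/-- Multiplication by `a ∈ A` on `Ann I` (well defined since `Ann I` is an ideal);
this gives the natural `A/I`-module structure on `Ann I`. -/
noncomputable def mulAnn (A : Type) [CommRing A] [Algebra ℂ A] (I : Ideal A) (a : A) :
    annSub A I →ₗ[ℂ] annSub A I where
  toFun x := ⟨a * (x : A), by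
    have hx : (x : A) ∈ Submodule.annihilator I := x.2
    refine Submodule.mem_annihilator.mpr fun n hn => ?_
    have h := Submodule.mem_annihilator.mp hx n hn
    rw [smul_eq_mul] at h ⊢
    rw [mul_assoc, h, mul_zero]⟩
  map_add' x y := by ext; simp [mul_add]
  map_smul' c x := by ext; simp [mul_smul_comm]

/-- For a Frobenius ℂ-algebra A and an ideal I ⊆ A, the A/I-module Ann I is
isomorphic to the coregular representation of A/I, i.e. the dual space (A/I)^* with the
action (a·ξ)(b) = ξ(ab); in particular the image of A/I in End(Ann I) is a maximal
commutative subalgebra. -/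
theorem stmt_8
    (A : Type) [CommRing A] [Algebra ℂ A] [FiniteDimensional ℂ A]
    (b : A →ₗ[ℂ] A →ₗ[ℂ] ℂ)
    (hsymm : ∀ x y : A, b x y = b y x)
    (hinv : ∀ x y z : A, b (x * y) z = b x (y * z))
    (hnondeg : ∀ x : A, (∀ y : A, b x y = 0) → x = 0)
    (I : Ideal A) :
    ∃ e : annSub A I ≃ₗ[ℂ] Module.Dual ℂ (A ⧸ I),
      (∀ (a : A) (x : annSub A I) (c : A ⧸ I),
        e (mulAnn A I a x) c = e x (Ideal.Quotient.mk I a * c)) ∧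
      (∀ T : annSub A I →ₗ[ℂ] annSub A I,
        (∀ a : A, T ∘ₗ mulAnn A I a = mulAnn A I a ∘ₗ T) →
        ∃ a : A, T = mulAnn A I a) := by
  classical
  have hmem : ∀ x : A, x ∈ annSub A I ↔ ∀ n ∈ I, x * n = 0 := by
    intro x
    constructor
    · intro hx n hn
      have hx' : x ∈ Submodule.annihilator I := hx
      exact Submodule.mem_annihilator.mp hx' n hn
    · intro h
      show x ∈ Submodule.annihilator I
      exact Submodule.mem_annihilator.mpr h
  have hb0 : ∀ x ∈ annSub A I, ∀ n ∈ I, b x n = 0 := by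
    intro x hx n hn
    have h := hinv x n 1
    rw [mul_one, (hmem x).1 hx n hn] at h
    rw [← h]; simp
  have hbinj : Function.Injective b := by
    rw [injective_iff_map_eq_zero]
    intro x hx
    exact hnondeg x (fun y => by rw [hx]; rfl)
  have hbsurj : Function.Surjective (b : A →ₗ[ℂ] Module.Dual ℂ A) :=
    (LinearMap.injective_iff_surjective_of_finrank_eq_finrank
      (Subspace.dual_finrank_eq (K := ℂ) (V := A)).symm).1 hbinj
  have hex : ∀ x : annSub A I, ∃ ξ : Module.Dual ℂ (A ⧸ I),
      ∀ y : A, ξ (Ideal.Quotient.mk I y) = b x y := by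
    intro x
    refine ⟨{ toFun := fun c => Quotient.liftOn' c (fun y => b x y) (by
            intro y z hyz
            have h1 : y - z ∈ I := (Submodule.quotientRel_def I).1 hyz
            have h2 := hb0 x x.2 _ h1
            rw [map_sub] at h2
            exact sub_eq_zero.1 h2)
              map_add' := ?_
              map_smul' := ?_ }, fun y => rfl⟩
    · intro c d
      induction c using Quotient.inductionOn'
      induction d using Quotient.inductionOn'
      exact map_add (b x) _ _
    · intro r c
      induction c using Quotient.inductionOn'
      exact map_smul (b x) _ _
  choose g hg using hex
  have hf : ∃ f : annSub A I →ₗ[ℂ] Module.Dual ℂ (A ⧸ I),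
      ∀ (x : annSub A I) (y : A), f x (Ideal.Quotient.mk I y) = b x y := by
    refine ⟨{ toFun := g, map_add' := ?_, map_smul' := ?_ }, hg⟩
    · intro x y
      apply LinearMap.ext
      intro c
      obtain ⟨z, rfl⟩ := Ideal.Quotient.mk_surjective c
      rw [LinearMap.add_apply, hg, hg, hg, Submodule.coe_add, map_add, LinearMap.add_apply]
    · intro r x
      apply LinearMap.ext
      intro c
      obtain ⟨z, rfl⟩ := Ideal.Quotient.mk_surjective c
      rw [RingHom.id_apply, LinearMap.smul_apply, hg, hg, Submodule.coe_smul, map_smul,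
        LinearMap.smul_apply]
  obtain ⟨f, hf⟩ := hf
  have hfinj : Function.Injective f := by
    rw [injective_iff_map_eq_zero]
    intro x hx
    apply Subtype.ext
    refine hnondeg x (fun y => ?_)
    rw [← hf, hx]; rfl
  have hfsurj : Function.Surjective f := by
    intro ξ
    obtain ⟨x, hx⟩ := hbsurj (ξ ∘ₗ (Ideal.Quotient.mkₐ ℂ I).toLinearMap)
    have hx' : ∀ y, b x y = ξ (Ideal.Quotient.mk I y) := fun y => by rw [hx]; rfl
    have hxm : x ∈ annSub A I := by
      rw [hmem]
      intro n hn
      refine hnondeg _ (fun y => ?_)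
      rw [hinv, hx', Ideal.Quotient.eq_zero_iff_mem.2 (I.mul_mem_right y hn), map_zero]
    refine ⟨⟨x, hxm⟩, ?_⟩
    apply LinearMap.ext
    intro c
    obtain ⟨y, rfl⟩ := Ideal.Quotient.mk_surjective c
    rw [hf, ← hx']
  have hmul : ∀ (a : A) (x : annSub A I), ((mulAnn A I a x : annSub A I) : A) = a * x :=
    fun _ _ => rfl
  let e := LinearEquiv.ofBijective f ⟨hfinj, hfsurj⟩
  have he : ∀ (x : annSub A I) (y : A), e x (Ideal.Quotient.mk I y) = b x y := hf
  refine ⟨e, ?_, ?_⟩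
  · intro a x c
    obtain ⟨y, rfl⟩ := Ideal.Quotient.mk_surjective c
    rw [← map_mul, he, he, hmul, mul_comm, hinv]
  · intro T hT
    let φ : Module.Dual ℂ (Module.Dual ℂ (A ⧸ I)) :=
      (b.flip 1) ∘ₗ (annSub A I).subtype ∘ₗ T ∘ₗ e.symm.toLinearMap
    obtain ⟨c, hc⟩ := (Module.evalEquiv ℂ (A ⧸ I)).surjective φ
    obtain ⟨a, rfl⟩ := Ideal.Quotient.mk_surjective c
    have key : ∀ x : annSub A I, b (T x) 1 = b x a := by
      intro x
      have h := congrArg (fun g => g (e x)) hc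
      have h2 : φ (e x) = b (T x) 1 := by simp [φ]
      rw [← h2, ← he]
      exact h.symm
    refine ⟨a, LinearMap.ext fun x => Subtype.ext ?_⟩
    rw [← sub_eq_zero]
    refine hnondeg _ (fun d => ?_)
    have h1 : T (mulAnn A I d x) = mulAnn A I d (T x) := congrArg (fun g => g x) (hT d)
    have h2 := key (mulAnn A I d x)
    rw [h1, hmul, hmul, mul_comm, hinv, mul_one, mul_comm, hinv] at h2
    rw [map_sub, LinearMap.sub_apply, h2, hmul, mul_comm a, hinv, mul_comm a, sub_self]
end

section
/- Let m ≥ 1 and let P_1,…,P_m be polynomials in ℂ[x_1,…,x_m]. Let I be the ideal of ℂ[x_1,…,x_m] generated by P_1,…,P_m. If the quotient algebra ℂ[x_1,…,x_m]/I is nonzero and finite-dimensional over ℂ, then it admits a nondegenerate symmetric ℂ-bilinear form (·,·) satisfying the invariance condition ((fg, h) = (f, gh) for all f, g, h), i.e. it is a Frobenius algebra. -/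
open MvPolynomial in
lemma aux_coeff_zero {m : ℕ} {f : MvPolynomial (Fin m) ℂ} {d : Fin m →₀ ℕ}
    (h : f.totalDegree < ∑ i, d i) : coeff d f = 0 := by
  apply coeff_eq_zero_of_totalDegree_lt
  refine lt_of_lt_of_eq h ?_
  symm
  apply Finset.sum_subset (Finset.subset_univ _)
  intro i _ hi
  simpa using hi

/-- exponent -/
noncomputable def auxE {m : ℕ} (N : ℕ) (k : Fin m → ℕ) : Fin m →₀ ℕ :=
  Finsupp.equivFunOnFinite.symm (fun i => (N + 1) * k i + N)

lemma auxE_apply {m : ℕ} (N : ℕ) (k : Fin m → ℕ) (i : Fin m) :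
    auxE N k i = (N + 1) * k i + N := rfl

/-- product of powers -/
noncomputable def auxL {m : ℕ} (L : Fin m → MvPolynomial (Fin m) ℂ) (k : Fin m → ℕ) :
    MvPolynomial (Fin m) ℂ := ∏ i, L i ^ k i

lemma auxL_deg {m : ℕ} {N : ℕ} {L : Fin m → MvPolynomial (Fin m) ℂ}
    (hL : ∀ i, (L i).totalDegree ≤ N) (k : Fin m → ℕ) :
    (auxL L k).totalDegree ≤ N * ∑ i, k i := by
  refine (MvPolynomial.totalDegree_finsetProd _ _).trans ?_
  rw [Finset.mul_sum]
  refine Finset.sum_le_sum fun i _ => ?_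
  refine (MvPolynomial.totalDegree_pow _ _).trans ?_
  rw [mul_comm]
  exact Nat.mul_le_mul_right _ (hL i)

lemma aux_term_zero {m : ℕ} {N : ℕ} {L : Fin m → MvPolynomial (Fin m) ℂ}
    (hL : ∀ i, (L i).totalDegree ≤ N) (f : MvPolynomial (Fin m) ℂ) (k : Fin m → ℕ)
    (h : f.totalDegree < ∑ i, k i + m * N) :
    MvPolynomial.coeff (auxE N k) (f * auxL L k) = 0 := by
  apply aux_coeff_zero
  have h1 := MvPolynomial.totalDegree_mul f (auxL L k)
  have h2 := auxL_deg hL k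
  have h3 : ∑ i, auxE N k i = (N + 1) * ∑ i, k i + m * N := by
    simp [auxE_apply, Finset.sum_add_distrib, Finset.mul_sum]
  rw [h3, add_mul]
  omega

lemma aux_fin {m : ℕ} {N : ℕ} {L : Fin m → MvPolynomial (Fin m) ℂ}
    (hL : ∀ i, (L i).totalDegree ≤ N) (f : MvPolynomial (Fin m) ℂ) :
    (Function.support fun k => MvPolynomial.coeff (auxE N k) (f * auxL L k)).Finite := by
  apply Set.Finite.subset (Set.finite_Iic (fun _ : Fin m => f.totalDegree))
  intro k hk i
  by_contra hc
  apply hk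
  apply aux_term_zero hL
  have : k i ≤ ∑ i, k i := Finset.single_le_sum (fun _ _ => Nat.zero_le _) (Finset.mem_univ i)
  simp only at hc
  omega

/-- the residue functional -/
noncomputable def auxPhi {m : ℕ} {N : ℕ} {L : Fin m → MvPolynomial (Fin m) ℂ}
    (hL : ∀ i, (L i).totalDegree ≤ N) : MvPolynomial (Fin m) ℂ →ₗ[ℂ] ℂ where
  toFun f := ∑ᶠ k : Fin m → ℕ, MvPolynomial.coeff (auxE N k) (f * auxL L k)
  map_add' f g := by
    rw [← finsum_add_distrib (aux_fin hL f) (aux_fin hL g)]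
    simp [add_mul]
  map_smul' c f := by
    simp only [smul_mul_assoc, MvPolynomial.coeff_smul, RingHom.id_apply]
    rw [smul_finsum]

lemma auxPhi_apply {m : ℕ} {N : ℕ} {L : Fin m → MvPolynomial (Fin m) ℂ}
    (hL : ∀ i, (L i).totalDegree ≤ N) (f : MvPolynomial (Fin m) ℂ) :
    auxPhi hL f = ∑ᶠ k : Fin m → ℕ, MvPolynomial.coeff (auxE N k) (f * auxL L k) := rfl

lemma auxPhi_low {m : ℕ} {N : ℕ} {L : Fin m → MvPolynomial (Fin m) ℂ}
    (hL : ∀ i, (L i).totalDegree ≤ N) (f : MvPolynomial (Fin m) ℂ)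
    (hf : f.totalDegree ≤ m * N) :
    auxPhi hL f = MvPolynomial.coeff (auxE N 0) f := by
  rw [auxPhi_apply, finsum_eq_single _ (0 : Fin m → ℕ)]
  · simp [auxL]
  · intro k hk
    apply aux_term_zero hL
    have : ∑ i, k i ≠ 0 := by
      intro h
      apply hk
      funext i
      simpa using (Finset.sum_eq_zero_iff.mp h) i (Finset.mem_univ i)
    omega

lemma auxPhi_gen {m : ℕ} {N : ℕ} {L : Fin m → MvPolynomial (Fin m) ℂ}
    (hL : ∀ i, (L i).totalDegree ≤ N) (g : MvPolynomial (Fin m) ℂ) (i : Fin m) :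
    auxPhi hL (g * (MvPolynomial.X i ^ (N + 1) - L i)) = 0 := by
  rw [mul_sub, map_sub, sub_eq_zero, auxPhi_apply, auxPhi_apply]
  have hinj : Function.Injective (fun k : Fin m → ℕ => k + Pi.single i 1) :=
    add_left_injective _
  have hX : ∀ k, g * MvPolynomial.X i ^ (N + 1) * auxL L k
      = g * auxL L k * MvPolynomial.monomial (Finsupp.single i (N + 1)) 1 := by
    intro k
    rw [MvPolynomial.X_pow_eq_monomial]; ring
  have hLs : ∀ k, auxL L (k + Pi.single i 1) = L i * auxL L k := by
    intro k
    simp only [auxL, Pi.add_apply, pow_add, Finset.prod_mul_distrib]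
    rw [mul_comm]
    congr 1
    rw [Finset.prod_eq_single i]
    · simp
    · intro j _ hj
      simp [Pi.single_eq_of_ne hj]
    · simp
  have key : ∀ k, MvPolynomial.coeff (auxE N k) (g * L i * auxL L k) =
      MvPolynomial.coeff (auxE N (k + Pi.single i 1))
        (g * MvPolynomial.X i ^ (N + 1) * auxL L (k + Pi.single i 1)) := by
    intro k
    rw [hX, hLs]
    have : auxE N (k + Pi.single i 1) = auxE N k + Finsupp.single i (N + 1) := by
      ext j
      by_cases hj : j = i
      · subst hj
        simp [auxE_apply]; ring
      · simp [auxE_apply, Pi.single_eq_of_ne hj, Finsupp.single_apply, Ne.symm hj]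
    rw [this, MvPolynomial.coeff_mul_monomial, mul_one, mul_assoc]
  rw [finsum_congr key, ← finsum_mem_range (f := fun k =>
    MvPolynomial.coeff (auxE N k) (g * MvPolynomial.X i ^ (N + 1) * auxL L k)) hinj]
  apply finsum_congr
  intro k
  classical
  by_cases hk : k ∈ Set.range (fun k : Fin m → ℕ => k + Pi.single i 1)
  · rw [finsum_eq_if, if_pos hk]
  · rw [finsum_eq_if, if_neg hk, hX, MvPolynomial.coeff_mul_monomial', if_neg]
    intro hle
    apply hk
    have h1 := hle i
    simp only [Finsupp.single_eq_same, auxE_apply] at h1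
    have h2 : k i ≠ 0 := by
      intro h0
      rw [h0] at h1
      omega
    refine ⟨k - Pi.single i 1, ?_⟩
    funext j
    by_cases hj : j = i
    · subst hj
      simp; omega
    · simp [Pi.single_eq_of_ne hj]

lemma auxPhi_ideal {m : ℕ} {N : ℕ} {L : Fin m → MvPolynomial (Fin m) ℂ}
    (hL : ∀ i, (L i).totalDegree ≤ N) (f : MvPolynomial (Fin m) ℂ)
    (hf : f ∈ Ideal.span (Set.range fun i => MvPolynomial.X i ^ (N + 1) - L i)) :
    auxPhi hL f = 0 := by
  obtain ⟨c, rfl⟩ := (Ideal.mem_span_range_iff_exists_fun).mp hf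
  rw [map_sum]
  exact Finset.sum_eq_zero fun i _ => auxPhi_gen hL _ i

lemma auxPhi_nondeg {m : ℕ} {N : ℕ} {L : Fin m → MvPolynomial (Fin m) ℂ}
    (hL : ∀ i, (L i).totalDegree ≤ N) (d : ℕ) : ∀ (f : MvPolynomial (Fin m) ℂ),
    (∀ a : Fin m →₀ ℕ, d ≤ ∑ i, a i → MvPolynomial.coeff a f = 0) →
    (∀ g, auxPhi hL (f * g) = 0) →
    f ∈ Ideal.span (Set.range fun i => MvPolynomial.X i ^ (N + 1) - L i) := by
  induction d with
  | zero =>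
    intro f hf _
    have : f = 0 := by
      ext a
      simpa using hf a (Nat.zero_le _)
    rw [this]; exact Ideal.zero_mem _
  | succ d ih =>
    intro f hf hg
    set I := Ideal.span (Set.range fun i => MvPolynomial.X i ^ (N + 1) - L i) with hI
    have hfd : f.totalDegree ≤ d := by
      rw [MvPolynomial.totalDegree_eq]
      refine Finset.sup_le fun a ha => ?_
      by_contra hc
      rw [MvPolynomial.mem_support_iff] at ha
      apply ha
      apply hf
      have h2 : (Finsupp.toMultiset a).card = ∑ i, a i := by
        rw [Finsupp.card_toMultiset, Finsupp.sum_fintype _ _ (fun _ => rfl)]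
        simp
      omega
    have step : ∀ a : Fin m →₀ ℕ, ∃ p ∈ I, ∀ b : Fin m →₀ ℕ, d ≤ ∑ i, b i →
        MvPolynomial.coeff b (MvPolynomial.monomial a (MvPolynomial.coeff a f) - p) = 0 := by
      intro a
      rcases lt_or_ge (∑ i, a i) d with h | h
      · refine ⟨0, I.zero_mem, fun b hb => ?_⟩
        rw [sub_zero, MvPolynomial.coeff_monomial, if_neg]
        rintro rfl
        omega
      by_cases hc : MvPolynomial.coeff a f = 0
      · exact ⟨0, I.zero_mem, fun b hb => by simp [hc]⟩
      have had : ∑ i, a i = d := by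
        by_contra hne
        exact hc (hf a (by omega))
      by_cases hex : ∃ i, N + 1 ≤ a i
      · obtain ⟨i, hi⟩ := hex
        have hle : Finsupp.single i (N + 1) ≤ a := by
          rw [Finsupp.single_le_iff]; exact hi
        set a' := a - Finsupp.single i (N + 1) with ha'
        have haa : a' + Finsupp.single i (N + 1) = a := tsub_add_cancel_of_le hle
        refine ⟨MvPolynomial.monomial a' (MvPolynomial.coeff a f) *
          (MvPolynomial.X i ^ (N + 1) - L i), I.mul_mem_left _ (Ideal.subset_span ⟨i, rfl⟩), ?_⟩
        intro b hb
        have hs : ∑ j, a' j + (N + 1) = d := by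
          rw [← had, ← haa]
          simp [Finset.sum_add_distrib, Finsupp.single_apply]
        have : MvPolynomial.monomial a (MvPolynomial.coeff a f) -
            MvPolynomial.monomial a' (MvPolynomial.coeff a f) *
            (MvPolynomial.X i ^ (N + 1) - L i) =
            MvPolynomial.monomial a' (MvPolynomial.coeff a f) * L i := by
          rw [mul_sub, MvPolynomial.X_pow_eq_monomial, MvPolynomial.monomial_mul, haa, mul_one]
          ring
        rw [this]
        apply aux_coeff_zero
        have h1 := MvPolynomial.totalDegree_mul
          (MvPolynomial.monomial a' (MvPolynomial.coeff a f)) (L i)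
        have h2 := MvPolynomial.totalDegree_monomial_le a' (MvPolynomial.coeff a f)
        have h3 := hL i
        rw [Finsupp.sum_fintype _ _ (fun _ => rfl)] at h2
        simp only [id] at h2
        omega
      · exfalso
        push Not at hex
        apply hc
        have hle : a ≤ auxE N 0 := by
          intro i
          have := hex i
          simp only [auxE_apply, Pi.zero_apply, mul_zero]
          omega
        set b := auxE N 0 - a with hb
        have hab : a + b = auxE N 0 := add_tsub_cancel_of_le hle
        have h1 := hg (MvPolynomial.monomial b 1)
        rw [auxPhi_low hL, ← hab, MvPolynomial.coeff_mul_monomial, mul_one] at h1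
        · exact h1
        · have h2 := MvPolynomial.totalDegree_mul f (MvPolynomial.monomial b 1)
          have h3 := MvPolynomial.totalDegree_monomial_le b (1 : ℂ)
          rw [Finsupp.sum_fintype _ _ (fun _ => rfl)] at h3
          simp only [id] at h3
          have h4 : ∑ i, a i + ∑ i, b i = m * N := by
            rw [← Finset.sum_add_distrib]
            have : ∀ i, a i + b i = N := by
              intro i
              have := DFunLike.congr_fun hab i
              simpa [auxE_apply] using this
            simp [this]
          omega
    choose p hpI hp using step
    have hdecomp : f - ∑ a ∈ f.support, p a = ∑ a ∈ f.support,
        (MvPolynomial.monomial a (MvPolynomial.coeff a f) - p a) := by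
      rw [Finset.sum_sub_distrib, ← MvPolynomial.as_sum]
    have hsum : ∑ a ∈ f.support, p a ∈ I := I.sum_mem fun a _ => hpI a
    have := ih (f - ∑ a ∈ f.support, p a) ?_ ?_
    · have h2 := I.add_mem this hsum
      simpa using h2
    · intro b hb
      rw [hdecomp, MvPolynomial.coeff_sum]
      exact Finset.sum_eq_zero fun a _ => hp a b hb
    · intro g
      rw [sub_mul, map_sub, hg, auxPhi_ideal hL _ (I.mul_mem_right _ hsum), sub_zero]

lemma auxPhi_nondeg' {m : ℕ} {N : ℕ} {L : Fin m → MvPolynomial (Fin m) ℂ}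
    (hL : ∀ i, (L i).totalDegree ≤ N) (f : MvPolynomial (Fin m) ℂ)
    (h : ∀ g, auxPhi hL (f * g) = 0) :
    f ∈ Ideal.span (Set.range fun i => MvPolynomial.X i ^ (N + 1) - L i) :=
  auxPhi_nondeg hL (f.totalDegree + 1) f (fun a ha => aux_coeff_zero (by omega)) h

/-- Perturbing the generators modulo the square of the ideal. -/
lemma aux_perturb {m : ℕ} (P : Fin m → MvPolynomial (Fin m) ℂ)
    (hfd : FiniteDimensional ℂ (MvPolynomial (Fin m) ℂ ⧸ Ideal.span (Set.range P))) :
    ∃ (N : ℕ) (L : Fin m → MvPolynomial (Fin m) ℂ), (∀ i, (L i).totalDegree ≤ N) ∧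
      ∀ i, MvPolynomial.X i ^ (N + 1) - L i - P i ∈
        Ideal.span (Set.range P) * Ideal.span (Set.range P) := by
  set I := Ideal.span (Set.range P) with hI
  have hq : ∀ i : Fin m, ∃ q : Polynomial ℂ, q.Monic ∧
      Polynomial.aeval (MvPolynomial.X i : MvPolynomial (Fin m) ℂ) q ∈ I := by
    intro i
    have hint : IsIntegral ℂ (Ideal.Quotient.mkₐ ℂ I (MvPolynomial.X i)) :=
      Algebra.IsIntegral.isIntegral _
    refine ⟨minpoly ℂ (Ideal.Quotient.mkₐ ℂ I (MvPolynomial.X i)), minpoly.monic hint, ?_⟩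
    have := minpoly.aeval ℂ (Ideal.Quotient.mkₐ ℂ I (MvPolynomial.X i))
    rw [Polynomial.aeval_algHom_apply] at this
    exact Ideal.Quotient.eq_zero_iff_mem.mp this
  choose q hqm hqI using hq
  set N := ∑ i, (P i).totalDegree + 2 * ∑ i, (q i).natDegree with hN
  have hPN : ∀ i, (P i).totalDegree ≤ N := by
    intro i
    have := Finset.single_le_sum (f := fun i => (P i).totalDegree)
      (fun _ _ => Nat.zero_le _) (Finset.mem_univ i)
    omega
  have hqN : ∀ i, 2 * (q i).natDegree ≤ N := by
    intro i
    have := Finset.single_le_sum (f := fun i => (q i).natDegree)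
      (fun _ _ => Nat.zero_le _) (Finset.mem_univ i)
    omega
  set Q : Fin m → Polynomial ℂ := fun i =>
    q i ^ 2 * Polynomial.X ^ (N + 1 - 2 * (q i).natDegree) with hQ
  have hQm : ∀ i, (Q i).Monic := fun i => ((hqm i).pow 2).mul (Polynomial.monic_X_pow _)
  have hQd : ∀ i, (Q i).natDegree = N + 1 := by
    intro i
    have := hqN i
    simp only [hQ]
    rw [((hqm i).pow 2).natDegree_mul (Polynomial.monic_X_pow _), (hqm i).natDegree_pow,
      Polynomial.natDegree_X_pow]
    omega
  have hlow : ∀ i, (Q i - Polynomial.X ^ (N + 1)).natDegree ≤ N := by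
    intro i
    rw [Polynomial.natDegree_le_iff_coeff_eq_zero]
    intro n hn
    rw [Polynomial.coeff_sub, Polynomial.coeff_X_pow]
    split_ifs with h
    · rw [h, ← hQd i, (hQm i).coeff_natDegree, sub_self]
    · rw [Polynomial.coeff_eq_zero_of_natDegree_lt, sub_zero]
      rw [hQd]; omega
  refine ⟨N, fun i => -(P i + Polynomial.aeval (MvPolynomial.X i : MvPolynomial (Fin m) ℂ)
    (Q i - Polynomial.X ^ (N + 1))), ?_, ?_⟩
  · intro i
    rw [MvPolynomial.totalDegree_neg]
    refine (MvPolynomial.totalDegree_add _ _).trans (max_le (hPN i) ?_)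
    rw [Polynomial.aeval_eq_sum_range]
    apply MvPolynomial.totalDegree_finsetSum_le
    intro j hj
    refine (MvPolynomial.totalDegree_smul_le _ _).trans ?_
    rw [MvPolynomial.totalDegree_X_pow]
    have := hlow i
    rw [Finset.mem_range] at hj
    omega
  · intro i
    have : MvPolynomial.X i ^ (N + 1) - -(P i +
        Polynomial.aeval (MvPolynomial.X i : MvPolynomial (Fin m) ℂ)
        (Q i - Polynomial.X ^ (N + 1))) - P i =
        (Polynomial.aeval (MvPolynomial.X i : MvPolynomial (Fin m) ℂ) (q i) *
        Polynomial.aeval (MvPolynomial.X i : MvPolynomial (Fin m) ℂ) (q i)) *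
        MvPolynomial.X i ^ (N + 1 - 2 * (q i).natDegree) := by
      simp only [hQ, map_sub, map_mul, map_pow, Polynomial.aeval_X]
      ring
    rw [this]
    exact Ideal.mul_mem_right _ _ (Ideal.mul_mem_mul (hqI i) (hqI i))

/-- If P₁,…,P_m ∈ ℂ[x₁,…,x_m] generate an ideal I such that
ℂ[x₁,…,x_m]/I is nonzero and finite-dimensional, then the quotient is a Frobenius
algebra: it admits a nondegenerate symmetric invariant bilinear form. -/
theorem stmt_9
    (m : ℕ) (hm : 1 ≤ m) (P : Fin m → MvPolynomial (Fin m) ℂ)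
    (hne : Nontrivial (MvPolynomial (Fin m) ℂ ⧸ Ideal.span (Set.range P)))
    (hfd : FiniteDimensional ℂ (MvPolynomial (Fin m) ℂ ⧸ Ideal.span (Set.range P))) :
    ∃ b : (MvPolynomial (Fin m) ℂ ⧸ Ideal.span (Set.range P)) →ₗ[ℂ]
        (MvPolynomial (Fin m) ℂ ⧸ Ideal.span (Set.range P)) →ₗ[ℂ] ℂ,
      (∀ x y, b x y = b y x) ∧
      (∀ x y z, b (x * y) z = b x (y * z)) ∧
      (∀ x, (∀ y, b x y = 0) → x = 0) := by
  obtain ⟨N, L, hL, hLP⟩ := aux_perturb P hfd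
  set I := Ideal.span (Set.range P) with hI
  set J := Ideal.span (Set.range fun i => MvPolynomial.X i ^ (N + 1) - L i) with hJ
  have hPI : ∀ i, P i ∈ I := fun i => Ideal.subset_span ⟨i, rfl⟩
  have hJI : J ≤ I := by
    rw [hJ, Ideal.span_le]
    rintro _ ⟨i, rfl⟩
    have := I.add_mem (Ideal.mul_le_left (hLP i)) (hPI i)
    simpa using this
  have hIJ : I ≤ J ⊔ I • I := by
    conv_lhs => rw [hI]
    rw [Ideal.span_le]
    rintro _ ⟨i, rfl⟩
    have h1 : MvPolynomial.X i ^ (N + 1) - L i ∈ J := Ideal.subset_span ⟨i, rfl⟩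
    have h2 := Submodule.sub_mem_sup h1 (show _ ∈ I • I from hLP i)
    simpa using h2
  obtain ⟨r, hr1, hr⟩ := Submodule.exists_sub_one_mem_and_smul_le_of_fg_of_le_sup
    (I := I) (N := J) (N' := I) (P := I) (IsNoetherian.noetherian I) le_rfl hIJ
  have hrI : ∀ f ∈ I, r * f ∈ J := fun f hf => hr (Submodule.smul_mem_pointwise_smul f r I hf)
  let ψ : (MvPolynomial (Fin m) ℂ ⧸ I) →ₗ[ℂ] ℂ :=
    (Submodule.liftQ (I.restrictScalars ℂ) (auxPhi hL ∘ₗ LinearMap.mulLeft ℂ r) (by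
      intro f hf
      exact auxPhi_ideal hL _ (hrI f hf)))
  have hψ : ∀ f, ψ (Ideal.Quotient.mk I f) = auxPhi hL (r * f) := fun f => rfl
  refine ⟨(LinearMap.mul ℂ (MvPolynomial (Fin m) ℂ ⧸ I)).compr₂ ψ, ?_, ?_, ?_⟩
  · intro x y
    simp [mul_comm]
  · intro x y z
    simp [mul_assoc]
  · intro x hx
    obtain ⟨f, rfl⟩ := Ideal.Quotient.mk_surjective x
    have h1 : r * f ∈ J := by
      apply auxPhi_nondeg' hL
      intro g
      have := hx (Ideal.Quotient.mk I g)
      rw [LinearMap.compr₂_apply, LinearMap.mul_apply', ← map_mul, hψ] at this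
      rw [mul_assoc]; exact this
    rw [Ideal.Quotient.eq_zero_iff_mem]
    have h2 := I.sub_mem (hJI h1) (I.mul_mem_right f hr1)
    have h3 : r * f - (r - 1) * f = f := by ring
    rwa [h3] at h2
end

section
/- Let N ≥ 1, let λ = (λ_1 ≥ … ≥ λ_N ≥ 0) be a partition with at most N parts, n = |λ| = Σ_i λ_i, and set d_i = λ_i + N − i. Let b_1,…,b_k be distinct complex numbers and λ^{(1)},…,λ^{(k)} partitions with at most N parts such that Σ_{s=1}^k |λ^{(s)}| = n; set n_s = |λ^{(s)}|. Suppose X ⊂ ℂ[u] is an N-dimensional linear subspace such that (a) X has a basis of monic polynomials of degrees d_1,…,d_N, and (b) for every s = 1,…,k and every j = 1,…,N, X contains a polynomial which vanishes at b_s to order exactly λ_j^{(s)} + N − j. Then the Wronskian of any basis of X equals c · ∏_{s=1}^k (u − b_s)^{n_s} for some nonzero constant c ∈ ℂ. -/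
/-- The Wronskian of N polynomials: the determinant of the N×N matrix whose (i,j) entry
is the (j−1)-st derivative of the i-th polynomial (indices 0-based). -/
noncomputable def wron (N : ℕ) (f : Fin N → Polynomial ℂ) : Polynomial ℂ :=
  (Matrix.of fun i j : Fin N => (Polynomial.derivative^[(j : ℕ)] (f i))).det

open Polynomial in
lemma aux_coeff_prod {ι : Type*} (s : Finset ι) (F : ι → ℂ[X]) (d : ι → ℕ)
    (h : ∀ i ∈ s, (F i).natDegree ≤ d i) :
    (∏ i ∈ s, F i).natDegree ≤ ∑ i ∈ s, d i ∧
    (∏ i ∈ s, F i).coeff (∑ i ∈ s, d i) = ∏ i ∈ s, (F i).coeff (d i) := by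
  classical
  induction s using Finset.induction_on with
  | empty => simp
  | insert a s ha ih =>
    obtain ⟨h1, h2⟩ := ih (fun i hi => h i (Finset.mem_insert_of_mem hi))
    have h3 := h a (Finset.mem_insert_self a s)
    rw [Finset.prod_insert ha, Finset.sum_insert ha, Finset.prod_insert ha]
    refine ⟨natDegree_mul_le_of_le h3 h1, ?_⟩
    rw [coeff_mul_add_eq_of_natDegree_le h3 h1, h2]

open Polynomial in
lemma aux_det {N : ℕ} (M : Matrix (Fin N) (Fin N) ℂ[X]) (d : Fin N → ℕ)
    (h : ∀ i j, (M i j).natDegree ≤ d i) :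
    M.det.natDegree ≤ ∑ i, d i ∧
    M.det.coeff (∑ i, d i) = (Matrix.of fun i j => (M i j).coeff (d i)).det := by
  rw [← Matrix.det_transpose M,
    ← Matrix.det_transpose (Matrix.of fun i j => (M i j).coeff (d i)),
    Matrix.det_apply, Matrix.det_apply]
  constructor
  · apply natDegree_sum_le_of_forall_le
    intro σ _
    refine (natDegree_smul_le _ _).trans ?_
    exact (aux_coeff_prod Finset.univ (fun i => M i (σ i)) d (fun i _ => h i _)).1
  · rw [finsetSum_coeff]
    refine Finset.sum_congr rfl fun σ _ => ?_
    rw [coeff_smul]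
    congr 1
    exact (aux_coeff_prod Finset.univ (fun i => M i (σ i)) d (fun i _ => h i _)).2

open Polynomial in
lemma aux_wron_deg {N : ℕ} (g : Fin N → ℂ[X]) (d : Fin N → ℕ) (hd : Function.Injective d)
    (hg : ∀ i, (g i).Monic) (hgd : ∀ i, (g i).natDegree = d i) :
    wron N g ≠ 0 ∧ (wron N g).natDegree + ∑ j : Fin N, (j : ℕ) = ∑ i, d i := by
  set M : Matrix (Fin N) (Fin N) ℂ[X] :=
    Matrix.of fun i j => X ^ (j : ℕ) * derivative^[(j : ℕ)] (g i) with hM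
  have hdet : M.det = X ^ (∑ j : Fin N, (j : ℕ)) * wron N g := by
    rw [← Finset.prod_pow_eq_pow_sum, wron, ← Matrix.det_mul_row]
    rfl
  have hdeg : ∀ i j, (M i j).natDegree ≤ d i := by
    intro i j
    simp only [hM, Matrix.of_apply]
    by_cases hj : (j : ℕ) ≤ d i
    · refine natDegree_mul_le.trans ?_
      have := natDegree_iterate_derivative (g i) j
      rw [natDegree_X_pow]
      rw [hgd] at this
      omega
    · rw [iterate_derivative_eq_zero (by rw [hgd]; omega)]
      simp
  obtain ⟨h1, h2⟩ := aux_det M d hdeg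
  have hco : ∀ i j, (M i j).coeff (d i) = (descPochhammer ℂ (j : ℕ)).eval (d i : ℂ) := by
    intro i j
    rw [descPochhammer_eval_eq_descFactorial]
    simp only [hM, Matrix.of_apply]
    rw [coeff_X_pow_mul']
    split_ifs with hj
    · rw [coeff_iterate_derivative, Nat.sub_add_cancel hj, ← hgd, (hg i).coeff_natDegree]
      simp
    · rw [Nat.descFactorial_of_lt (by omega)]; simp
  have hne : (Matrix.of fun i j => (M i j).coeff (d i)).det ≠ 0 := by
    simp_rw [hco]
    rw [← Matrix.det_eval_matrixOfPolynomials_eq_det_vandermonde (fun i => (d i : ℂ))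
      (fun j : Fin N => descPochhammer ℂ (j : ℕ)) (fun i => descPochhammer_natDegree ℂ _)
      (fun i => monic_descPochhammer ℂ _), Matrix.det_vandermonde_ne_zero_iff]
    intro i j hij
    exact hd (Nat.cast_injective (R := ℂ) hij)
  rw [← h2] at hne
  have h3 := le_natDegree_of_ne_zero hne
  have hM0 : M.det ≠ 0 := by rintro h; simp [h] at hne
  have hw : wron N g ≠ 0 := by rintro h; simp [hdet, h] at hM0
  refine ⟨hw, ?_⟩
  have h4 : M.det.natDegree = _ := le_antisymm h1 h3
  rw [hdet, natDegree_X_pow_mul _ hw] at h4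
  exact h4

open Polynomial in
lemma aux_wron_dvd {N : ℕ} (p : Fin N → ℂ[X]) (b : ℂ) (m : Fin N → ℕ) (n : ℕ)
    (hm : ∑ i, m i = n + ∑ j : Fin N, (j : ℕ))
    (hp : ∀ i, (X - C b) ^ m i ∣ p i) : (X - C b) ^ n ∣ wron N p := by
  rw [wron, ← Matrix.det_transpose, Matrix.det_apply]
  refine Finset.dvd_sum fun σ _ => ?_
  refine Dvd.dvd.trans ?_ (dvd_of_eq (Units.smul_def _ _).symm)
  apply dvd_smul_of_dvd
  have h1 : (X - C b) ^ (∑ i, (m i - (σ i : ℕ))) ∣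
      ∏ i, (Matrix.of fun i j : Fin N => (derivative^[(j : ℕ)] (p i))).transpose (σ i) i := by
    rw [← Finset.prod_pow_eq_pow_sum]
    refine Finset.prod_dvd_prod_of_dvd _ _ fun i _ => ?_
    simp only [Matrix.transpose_apply, Matrix.of_apply]
    exact pow_sub_dvd_iterate_derivative_of_pow_dvd _ (hp i)
  refine (pow_dvd_pow _ ?_).trans h1
  have h2 : ∑ i, (σ i : ℕ) = ∑ j : Fin N, (j : ℕ) := Equiv.sum_comp σ (fun j : Fin N => (j : ℕ))
  have h3 : ∑ i, m i ≤ ∑ i, ((m i - (σ i : ℕ)) + (σ i : ℕ)) :=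
    Finset.sum_le_sum fun i _ => by omega
  rw [Finset.sum_add_distrib] at h3
  omega

open Polynomial in
lemma aux_wron_lin {N : ℕ} (f p : Fin N → ℂ[X]) (A : Matrix (Fin N) (Fin N) ℂ)
    (h : ∀ i, ∑ j, A i j • f j = p i) : wron N p = C A.det * wron N f := by
  rw [wron, wron, RingHom.map_det, ← Matrix.det_mul]
  congr 1
  ext1 i j
  simp only [Matrix.of_apply, Matrix.mul_apply, RingHom.mapMatrix_apply, Matrix.map_apply]
  rw [← h, iterate_derivative_sum]
  refine Finset.sum_congr rfl fun l _ => ?_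
  rw [iterate_derivative_smul, smul_eq_C_mul]

open Polynomial in
lemma aux_indep {N : ℕ} (p : Fin N → ℂ[X]) (b : ℂ) (hp : ∀ i, p i ≠ 0)
    (hm : StrictAnti fun i => (p i).rootMultiplicity b) (v : Fin N → ℂ)
    (hv : ∑ i, v i • p i = 0) : v = 0 := by
  by_contra hv0
  have hS : (Finset.univ.filter fun i => v i ≠ 0).Nonempty := by
    obtain ⟨i, hi⟩ := Function.ne_iff.mp hv0
    exact ⟨i, by simpa using hi⟩
  obtain ⟨i, hi, hmax⟩ := Finset.exists_max_image _ id hS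
  simp only [Finset.mem_filter, Finset.mem_univ, true_and, id] at hi hmax
  have hd : (X - C b) ^ ((p i).rootMultiplicity b + 1) ∣ v i • p i := by
    rw [← Finset.add_sum_erase _ _ (Finset.mem_univ i)] at hv
    rw [eq_neg_of_add_eq_zero_left hv, dvd_neg]
    refine Finset.dvd_sum fun j hj => ?_
    by_cases hvj : v j = 0
    · simp [hvj]
    · have hlt : j < i := lt_of_le_of_ne (hmax j hvj) (Finset.ne_of_mem_erase hj)
      rw [smul_eq_C_mul]
      exact ((pow_dvd_pow _ (hm hlt)).trans (pow_rootMultiplicity_dvd (p j) b)).mul_left _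
  have hd2 : (X - C b) ^ ((p i).rootMultiplicity b + 1) ∣ p i := by
    have := dvd_smul_of_dvd (v i)⁻¹ hd
    rwa [inv_smul_smul₀ hi] at this
  have := (le_rootMultiplicity_iff (hp i)).2 hd2
  omega

/-- Let λ be a partition with at most N parts, n = |λ|, d_i = λ_i + N − i,
let b₁,…,b_k be distinct complex numbers and λ^{(1)},…,λ^{(k)} partitions with at most N
parts with Σ_s |λ^{(s)}| = n, n_s = |λ^{(s)}|.  If an N-dimensional subspace X ⊂ ℂ[u]
has a basis of monic polynomials of degrees d₁,…,d_N and contains, for each s and each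
j = 1,…,N, a polynomial vanishing at b_s to order exactly λ_j^{(s)} + N − j, then the
Wronskian of any basis of X equals c·∏_s (u − b_s)^{n_s} for some nonzero constant c.
(Indices below are 0-based, so d_i = λ_i + (N − 1 − i).) -/
theorem stmt_11 (N : ℕ) (hN : 1 ≤ N)
    (lam : Fin N → ℕ) (hlam : Antitone lam)
    (k : ℕ) (hk : 1 ≤ k) (b : Fin k → ℂ) (hb : Function.Injective b)
    (lamS : Fin k → Fin N → ℕ) (hlamS : ∀ s, Antitone (lamS s))
    (hsum : ∑ s, ∑ j, lamS s j = ∑ i, lam i)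
    (X : Submodule ℂ (Polynomial ℂ))
    (hdim : Module.finrank ℂ X = N)
    (hmonic : ∃ g : Fin N → Polynomial ℂ, (∀ i, g i ∈ X ∧ (g i).Monic ∧
      (g i).natDegree = lam i + (N - 1 - (i : ℕ))))
    (hvanish : ∀ (s : Fin k) (j : Fin N), ∃ p ∈ X, p ≠ 0 ∧
      p.rootMultiplicity (b s) = lamS s j + (N - 1 - (j : ℕ)))
    (f : Fin N → Polynomial ℂ) (hfX : ∀ i, f i ∈ X)
    (hli : LinearIndependent ℂ f)
    (hspan : Submodule.span ℂ (Set.range f) = X) :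
    ∃ c : ℂ, c ≠ 0 ∧
      wron N f = Polynomial.C c *
        ∏ s : Fin k, (Polynomial.X - Polynomial.C (b s)) ^ (∑ j, lamS s j) := by
  classical
  have hNsum : ∑ i : Fin N, (N - 1 - (i : ℕ)) = ∑ j : Fin N, (j : ℕ) := by
    rw [← Equiv.sum_comp Fin.revPerm (fun j : Fin N => (j : ℕ))]
    refine Finset.sum_congr rfl fun i _ => ?_
    simp [Fin.val_rev]
    omega
  have hanti : ∀ l : Fin N → ℕ, Antitone l →
      StrictAnti fun i : Fin N => l i + (N - 1 - (i : ℕ)) := by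
    intro l hl i j hij
    have h1 := hl hij.le
    have h2 : (i : ℕ) < j := hij
    have h3 := j.2
    show l j + (N - 1 - (j : ℕ)) < l i + (N - 1 - (i : ℕ))
    omega
  have hrep : ∀ p : Fin N → Polynomial ℂ, (∀ i, p i ∈ X) →
      ∃ A : Matrix (Fin N) (Fin N) ℂ, ∀ i, ∑ j, A i j • f j = p i := by
    intro p hp
    have : ∀ i, ∃ c : Fin N → ℂ, ∑ j, c j • f j = p i := fun i =>
      (Submodule.mem_span_range_iff_exists_fun ℂ).1 (hspan ▸ hp i)
    choose A hA using this
    exact ⟨A, hA⟩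
  obtain ⟨g, hg⟩ := hmonic
  obtain ⟨hg0, hgdeg⟩ := aux_wron_deg g (fun i => lam i + (N - 1 - (i : ℕ)))
    (hanti lam hlam).injective (fun i => (hg i).2.1) (fun i => (hg i).2.2)
  obtain ⟨B, hB⟩ := hrep g (fun i => (hg i).1)
  rw [aux_wron_lin f g B hB] at hg0 hgdeg
  have hBdet : B.det ≠ 0 := by rintro h; simp [h] at hg0
  have hf0 : wron N f ≠ 0 := by rintro h; simp [h] at hg0
  rw [Polynomial.natDegree_C_mul hBdet, Finset.sum_add_distrib, hNsum] at hgdeg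
  have hdeg : (wron N f).natDegree = ∑ i, lam i := by omega
  have hdvd : ∀ s, (Polynomial.X - Polynomial.C (b s)) ^ (∑ j, lamS s j) ∣ wron N f := by
    intro s
    choose p hpX hp0 hpm using hvanish s
    obtain ⟨A, hA⟩ := hrep p hpX
    have hAdet : A.det ≠ 0 := by
      intro h
      obtain ⟨v, hv0, hv⟩ := Matrix.exists_vecMul_eq_zero_iff.2 h
      apply hv0
      apply aux_indep p (b s) hp0
      · simp_rw [hpm]; exact hanti _ (hlamS s)
      · simp_rw [← hA, Finset.smul_sum, smul_smul]
        rw [Finset.sum_comm]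
        refine Finset.sum_eq_zero fun j _ => ?_
        rw [← Finset.sum_smul]
        have := congrFun hv j
        simp only [Matrix.vecMul, dotProduct, Pi.zero_apply] at this
        rw [this, zero_smul]
    have h1 := aux_wron_dvd p (b s) (fun j => lamS s j + (N - 1 - (j : ℕ))) (∑ j, lamS s j)
      (by rw [Finset.sum_add_distrib, hNsum])
      (fun i => by rw [← hpm]; exact Polynomial.pow_rootMultiplicity_dvd _ _)
    rw [aux_wron_lin f p A hA] at h1
    exact (IsUnit.dvd_mul_left (Polynomial.isUnit_C.2 (isUnit_iff_ne_zero.2 hAdet))).1 h1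
  have hall : ∏ s : Fin k, (Polynomial.X - Polynomial.C (b s)) ^ (∑ j, lamS s j) ∣ wron N f := by
    apply Finset.prod_dvd_of_coprime
    · intro i _ j _ hij
      exact (Polynomial.pairwise_coprime_X_sub_C hb hij).pow
    · exact fun s _ => hdvd s
  obtain ⟨q, hq⟩ := hall
  have hPm : (∏ s : Fin k, (Polynomial.X - Polynomial.C (b s)) ^ (∑ j, lamS s j)).Monic :=
    Polynomial.monic_prod_of_monic _ _ fun s _ => (Polynomial.monic_X_sub_C _).pow _
  have hPd : (∏ s : Fin k, (Polynomial.X - Polynomial.C (b s)) ^ (∑ j, lamS s j)).natDegree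
      = ∑ i, lam i := by
    rw [Polynomial.natDegree_prod_of_monic _ _ fun s _ => (Polynomial.monic_X_sub_C _).pow _,
      ← hsum]
    simp
  have hq0 : q ≠ 0 := by rintro rfl; simp [hq] at hf0
  have hqd : q.natDegree = 0 := by
    have := hPm.natDegree_mul' hq0
    rw [← hq, hdeg, hPd] at this
    omega
  obtain ⟨c, rfl⟩ := Polynomial.natDegree_eq_zero.1 hqd
  refine ⟨c, by simpa using hq0, ?_⟩
  rw [hq, mul_comm]
end

section
/- Let N ≥ 1, let λ = (λ_1 ≥ … ≥ λ_N ≥ 0) be a partition with at most N parts with n = |λ|, and set d_i = λ_i + N − i. For any monic polynomial W ∈ ℂ[u] of degree n, the set of N-dimensional linear subspaces X ⊂ ℂ[u] which have a basis of monic polynomials of degrees d_1,…,d_N and whose Wronskian, normalized to be monic, equals W, is a finite set. -/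
open MvPolynomial in
theorem comp_mem_aux {σ ι : Type} (w : σ → ℕ) (Φ : ι → MvPolynomial σ ℂ) (k : ι → ℕ)
    (hΦ : ∀ j, IsWeightedHomogeneous w (Φ j) (k j))
    (p : MvPolynomial σ ℂ) (hp : p ∈ Ideal.span (Set.range Φ)) (d : ℕ) :
    weightedHomogeneousComponent w d p ∈ Submodule.span ℂ
      {q | ∃ (b : σ →₀ ℕ) (j : ι), Finsupp.weight w b + k j = d ∧ q = monomial b 1 * Φ j} := by
  classical
  induction hp using Submodule.span_induction with
  | mem x hx =>
    obtain ⟨j, rfl⟩ := hx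
    by_cases h : d = k j
    · subst h
      rw [(hΦ j).weightedHomogeneousComponent_same]
      exact Submodule.subset_span ⟨0, j, by simp, by simp⟩
    · rw [(hΦ j).weightedHomogeneousComponent_ne d h]
      exact zero_mem _
  | zero => simp
  | add x y _ _ hx hy => rw [map_add]; exact add_mem hx hy
  | smul a x hx _ =>
    clear * - hΦ hx
    induction hx using Submodule.span_induction generalizing a with
    | zero => simp
    | add x y _ _ hx hy => rw [smul_add, map_add]; exact add_mem (hx a) (hy a)
    | smul b x _ h => rw [smul_smul]; exact h _
    | mem x hx =>
      obtain ⟨j, rfl⟩ := hx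
      rw [a.as_sum, smul_eq_mul, Finset.sum_mul, map_sum]
      refine sum_mem fun b _ => ?_
      have h1 : monomial b (coeff b a) * Φ j = C (coeff b a) * (monomial b 1 * Φ j) := by
        rw [← mul_assoc, C_mul_monomial, mul_one]
      have h2 : IsWeightedHomogeneous w (monomial b 1 * Φ j) (Finsupp.weight w b + k j) :=
        (isWeightedHomogeneous_monomial w b 1 rfl).mul (hΦ j)
      rw [h1, weightedHomogeneousComponent_C_mul, ← smul_eq_C_mul]
      refine Submodule.smul_mem _ _ ?_
      by_cases h : d = Finsupp.weight w b + k j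
      · subst h
        rw [h2.weightedHomogeneousComponent_same]
        exact Submodule.subset_span ⟨b, j, rfl, rfl⟩
      · rw [h2.weightedHomogeneousComponent_ne d h]
        exact zero_mem _

open MvPolynomial in
theorem finite_fiber {σ ι : Type} [Finite σ] (w : σ → ℕ) 
    (Φ : ι → MvPolynomial σ ℂ) (k : ι → ℕ) (hk : ∀ j, 0 < k j)
    (hΦ : ∀ j, IsWeightedHomogeneous w (Φ j) (k j))
    (hV : ∀ x : σ → ℂ, (∀ j, eval x (Φ j) = 0) → x = 0) (c : ι → ℂ) :
    {x : σ → ℂ | ∀ j, eval x (Φ j) = c j}.Finite := by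
  classical
  set I := Ideal.span (Set.range Φ) with hI
  set J := Ideal.span (Set.range fun j => Φ j - C (c j)) with hJ
  have h1 : ∀ i, ∃ m : ℕ, (X i : MvPolynomial σ ℂ) ^ m ∈ I := by
    intro i
    have : (X i : MvPolynomial σ ℂ) ∈ I.radical := by
      rw [← vanishingIdeal_zeroLocus_eq_radical (K := ℂ) I]
      intro x hx
      have := hV x (fun j => by
        have := hx (Φ j) (Ideal.subset_span ⟨j, rfl⟩)
        simpa [aeval_eq_eval] using this)
      simp [this]
    exact this
  choose m hm using h1
  have hS : {a : σ →₀ ℕ | ∀ i, a i < m i}.Finite := by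
    have := Fintype.ofFinite σ
    refine (Set.finite_Iic (Finsupp.equivFunOnFinite.symm m)).subset ?_
    intro a ha i
    exact (ha i).le
  set S : Set (MvPolynomial σ ℂ) := (fun a => monomial a (1:ℂ)) '' {a : σ →₀ ℕ | ∀ i, a i < m i}
  set M : Submodule ℂ (MvPolynomial σ ℂ) := Submodule.span ℂ S ⊔ J.restrictScalars ℂ with hM
  have key : ∀ d : ℕ, ∀ a : σ →₀ ℕ, Finsupp.weight w a = d → monomial a (1:ℂ) ∈ M := by
    intro d
    induction d using Nat.strong_induction_on with
    | _ d ih =>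
    intro a ha
    by_cases h : ∀ i, a i < m i
    · exact Submodule.mem_sup_left (Submodule.subset_span ⟨a, h, rfl⟩)
    · push Not at h
      obtain ⟨i, hi⟩ := h
      have h2 : monomial a (1:ℂ) ∈ I := by
        have : monomial a (1:ℂ) = monomial (a - Finsupp.single i (m i)) 1 * X i ^ m i := by
          rw [X_pow_eq_monomial, monomial_mul, tsub_add_cancel_of_le (by simpa using hi), mul_one]
        rw [this]
        exact Ideal.mul_mem_left _ _ (hm i)
      have h3 := comp_mem_aux w Φ k hΦ _ h2 d
      rw [(isWeightedHomogeneous_monomial w a 1 ha).weightedHomogeneousComponent_same] at h3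
      refine Submodule.span_le.2 ?_ h3
      rintro q ⟨b, j, hb, rfl⟩
      have h4 : monomial b 1 * Φ j = monomial b 1 * (Φ j - C (c j)) + c j • monomial b 1 := by
        rw [smul_eq_C_mul]; ring
      rw [SetLike.mem_coe, h4]
      refine add_mem (Submodule.mem_sup_right ?_) (Submodule.smul_mem _ _ (ih _ ?_ b rfl))
      · exact Ideal.mul_mem_left _ _ (Ideal.subset_span ⟨j, rfl⟩)
      · have := hk j; omega
  have hMtop : M = ⊤ := by
    rw [eq_top_iff]
    intro p _
    rw [p.as_sum]
    refine sum_mem fun a _ => ?_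
    have := M.smul_mem (coeff a p) (key _ a rfl)
    rwa [smul_monomial, smul_eq_mul, mul_one] at this
  have hfin : Module.Finite ℂ (MvPolynomial σ ℂ ⧸ J) := by
    refine ⟨⟨((hS.image (fun a => monomial a (1:ℂ))).image (Ideal.Quotient.mkₐ ℂ J)).toFinset, ?_⟩⟩
    rw [Set.Finite.coe_toFinset, eq_top_iff]
    intro y _
    obtain ⟨p, rfl⟩ := Ideal.Quotient.mk_surjective y
    have hp : p ∈ M := hMtop ▸ Submodule.mem_top
    obtain ⟨s, hs, t, ht, rfl⟩ := Submodule.mem_sup.1 hp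
    have ht' : Ideal.Quotient.mk J t = 0 := Ideal.Quotient.eq_zero_iff_mem.2 ht
    rw [map_add, ht', add_zero]
    have := Submodule.mem_map_of_mem (f := (Ideal.Quotient.mkₐ ℂ J).toLinearMap) hs
    rw [Submodule.map_span] at this
    exact this
  have hint : ∀ i, ∃ q : Polynomial ℂ, q.Monic ∧ Polynomial.aeval (X i : MvPolynomial σ ℂ) q ∈ J := by
    intro i
    obtain ⟨q, hq, h⟩ := Algebra.IsIntegral.isIntegral (R := ℂ) (Ideal.Quotient.mk J (X i))
    refine ⟨q, hq, ?_⟩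
    rw [← Ideal.Quotient.eq_zero_iff_mem, ← h]
    change Ideal.Quotient.mkₐ ℂ J _ = Polynomial.aeval (Ideal.Quotient.mkₐ ℂ J (X i)) q
    rw [Polynomial.aeval_algHom_apply]
  choose q hq hqJ using hint
  refine (Set.Finite.pi' (t := fun i => {z | z ∈ (q i).roots}) fun i => ?_).subset ?_
  · exact ((q i).roots.toFinset.finite_toSet).subset (by intro z hz; simpa using hz)
  · intro x hx i
    have hle : J ≤ RingHom.ker (aeval (R := ℂ) x) := by
      rw [hJ, Ideal.span_le]
      rintro _ ⟨j, rfl⟩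
      simp [aeval_eq_eval, hx j]
    have := hle (hqJ i)
    rw [RingHom.mem_ker, ← Polynomial.aeval_algHom_apply] at this
    rw [Set.mem_ofPred_eq, Polynomial.mem_roots (hq i).ne_zero]
    simpa [Polynomial.IsRoot] using this

section
open Polynomial

noncomputable def LL {R : Type*} [CommRing R] (j : ℕ) (p : R[X]) : R[X] := X ^ j * derivative^[j] p

theorem LL_coeff {R : Type*} [CommRing R] (j : ℕ) (p : R[X]) (k : ℕ) :
    (LL j p).coeff k = (k.descFactorial j : R) * p.coeff k := by
  unfold LL
  rw [coeff_X_pow_mul']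
  split_ifs with h
  · rw [coeff_iterate_derivative, Nat.sub_add_cancel h, nsmul_eq_mul]
  · rw [Nat.descFactorial_of_lt (by omega)]; simp

noncomputable def wrp {R : Type*} [CommRing R] {N : ℕ} (h : Fin N → R[X]) : R[X] :=
  (Matrix.of fun i j : Fin N => LL (j : ℕ) (h i)).det

theorem wrp_map {R S : Type*} [CommRing R] [CommRing S] (φ : R →+* S) {N : ℕ} (h : Fin N → R[X]) :
    (wrp h).map φ = wrp (fun i => (h i).map φ) := by
  unfold wrp
  rw [← coe_mapRingHom, RingHom.map_det]
  congr 1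
  ext i j k
  simp [LL_coeff]

theorem wrp_eq {R : Type*} [CommRing R] {N : ℕ} (h : Fin N → R[X]) :
    wrp h = X ^ (∑ j : Fin N, (j : ℕ)) *
      (Matrix.of fun i j : Fin N => (derivative^[(j : ℕ)] (h i))).det := by
  rw [← Finset.prod_pow_eq_pow_sum, ← Matrix.det_mul_row]
  rfl

theorem wrp_lin {R : Type*} [CommRing R] {N : ℕ} (f g : Fin N → R[X]) (B : Matrix (Fin N) (Fin N) R)
    (h : ∀ i, f i = ∑ k, C (B i k) * g k) : wrp f = C B.det * wrp g := by
  unfold wrp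
  rw [RingHom.map_det, ← Matrix.det_mul]
  congr 1
  ext i j k
  simp only [Matrix.of_apply, LL_coeff, Matrix.mul_apply, RingHom.mapMatrix_apply, Matrix.map_apply,
    finsetSum_coeff, coeff_C_mul, h i, Finset.mul_sum]
  exact Finset.sum_congr rfl fun _ _ => by ring

theorem wrp_update {R : Type*} [CommRing R] {N : ℕ} (h : Fin N → R[X]) (i j : Fin N) (hij : i ≠ j)
    (a : R) : wrp (Function.update h i (h i + C a * h j)) = wrp h := by
  unfold wrp
  refine Eq.trans ?_ (Matrix.det_updateRow_add_smul_self _ hij (C a))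
  congr 1
  ext r s k
  by_cases hr : r = i
  · subst hr
    simp [LL_coeff]; ring
  · simp [hr, LL_coeff]

theorem order_lemma {N : ℕ} (h : Fin N → ℂ[X]) (e : Fin N → ℕ) (he : Function.Injective e)
    (h0 : ∀ i, ∀ k < e i, (h i).coeff k = 0) (h1 : ∀ i, (h i).coeff (e i) ≠ 0) :
    (wrp h).coeff (∑ i, e i) ≠ 0 := by
  have hdvd : ∀ i (j : Fin N), ∃ r, LL (j : ℕ) (h i) = X ^ e i * r := by
    intro i j
    refine X_pow_dvd_iff.2 fun k hk => ?_
    rw [LL_coeff, h0 i k hk, mul_zero]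
  choose r hr using hdvd
  have hr0 : ∀ i j, (r i j).coeff 0 = (h i).coeff (e i) * ((descPochhammer ℂ j).eval (e i : ℂ)) := by
    intro i j
    have := LL_coeff (j : ℕ) (h i) (e i)
    rw [hr, coeff_X_pow_mul', if_pos le_rfl, Nat.sub_self] at this
    rw [this, descPochhammer_eval_eq_descFactorial, mul_comm]
  have h2 : wrp h = X ^ (∑ i, e i) * (Matrix.of r).det := by
    rw [← Finset.prod_pow_eq_pow_sum, ← Matrix.det_mul_column]
    unfold wrp
    congr 1
    ext i j : 2
    simp [hr]
  rw [h2, coeff_X_pow_mul', if_pos le_rfl, Nat.sub_self, ← constantCoeff_apply, RingHom.map_det]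
  have h3 : (constantCoeff.mapMatrix (Matrix.of r)) = Matrix.of fun i j => (h i).coeff (e i) *
      (Matrix.of fun i j : Fin N => ((descPochhammer ℂ j).eval (e i : ℂ))) i j := by
    ext i j
    simp [hr0]
  rw [h3, Matrix.det_mul_column, ← Matrix.det_eval_matrixOfPolynomials_eq_det_vandermonde
    (fun i => (e i : ℂ)) (fun j : Fin N => descPochhammer ℂ j) (fun j => descPochhammer_natDegree ℂ j)
    (fun j => monic_descPochhammer ℂ j)]
  refine mul_ne_zero (Finset.prod_ne_zero_iff.2 fun i _ => h1 i) ?_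
  rw [Matrix.det_vandermonde_ne_zero_iff]
  intro a b hab
  exact he (Nat.cast_injective hab)

theorem bruhat {N : ℕ} (d : Fin N → ℕ) (hd : StrictAnti d) (g : Fin N → ℂ[X]) (w : ℂ[X]) (m : ℕ) :
    ∀ h : Fin N → ℂ[X], (∀ i, (h i).Monic) → (∀ i, (h i).natDegree = d i) → wrp h = w →
    (∀ i, g i ∈ Submodule.span ℂ (Set.range h)) →
    ∑ i, d i - ∑ i, (h i).natTrailingDegree = m →
    ∃ h : Fin N → ℂ[X], (∀ i, (h i).Monic) ∧ (∀ i, (h i).natDegree = d i) ∧ wrp h = w ∧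
    (∀ i, g i ∈ Submodule.span ℂ (Set.range h)) ∧
    Function.Injective fun i => (h i).natTrailingDegree := by
  induction m using Nat.strong_induction_on with
  | _ m ih =>
  intro h hm hdeg hw hg hs
  by_cases hinj : Function.Injective fun i => (h i).natTrailingDegree
  · exact ⟨h, hm, hdeg, hw, hg, hinj⟩
  have : ∃ i j, i < j ∧ (h i).natTrailingDegree = (h j).natTrailingDegree := by
    simp only [Function.Injective, not_forall] at hinj
    obtain ⟨i, j, hij, hne⟩ := hinj
    rcases lt_or_gt_of_ne hne with h | h
    · exact ⟨i, j, h, hij⟩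
    · exact ⟨j, i, h, hij.symm⟩
  obtain ⟨i, j, hij, he⟩ := this
  have hdd := hd hij
  set e := (h j).natTrailingDegree with hedef
  have hc : (h j).coeff e ≠ 0 := by
    have := (trailingCoeff_nonzero_iff_nonzero (p := h j)).2 (hm j).ne_zero
    exact this
  set a : ℂ := -((h i).coeff e / (h j).coeff e) with ha
  have hlt : (C a * h j).degree < (h i).degree := by
    rw [← smul_eq_C_mul]
    refine lt_of_le_of_lt (degree_smul_le a (h j)) ?_
    rw [degree_eq_natDegree (hm j).ne_zero, degree_eq_natDegree (hm i).ne_zero, hdeg, hdeg]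
    exact_mod_cast hdd
  have hmon : (h i + C a * h j).Monic := (hm i).add_of_left hlt
  have hnd : (h i + C a * h j).natDegree = d i := by
    rw [natDegree_add_eq_left_of_degree_lt hlt, hdeg]
  have htr : e < (h i + C a * h j).natTrailingDegree := by
    refine Nat.lt_of_succ_le (le_natTrailingDegree hmon.ne_zero fun k hk => ?_)
    rw [coeff_add, coeff_C_mul]
    rcases (Nat.lt_succ_iff.1 hk).lt_or_eq with hk | rfl
    · rw [coeff_eq_zero_of_lt_natTrailingDegree (he ▸ hk), coeff_eq_zero_of_lt_natTrailingDegree hk]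
      simp
    · rw [ha]; field_simp; ring
  set h' := Function.update h i (h i + C a * h j) with hh'
  have hi' : h' i = h i + C a * h j := by simp [hh']
  have hk' : ∀ k, k ≠ i → h' k = h k := fun k hk => by simp [hh', hk]
  have hm' : ∀ k, (h' k).Monic := by
    intro k
    by_cases hk : k = i
    · subst hk; rw [hi']; exact hmon
    · rw [hk' k hk]; exact hm k
  have hd' : ∀ k, (h' k).natDegree = d k := by
    intro k
    by_cases hk : k = i
    · subst hk; rw [hi']; exact hnd
    · rw [hk' k hk]; exact hdeg k
  have hle : ∑ k, (h' k).natTrailingDegree ≤ ∑ k, d k :=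
    Finset.sum_le_sum fun k _ => hd' k ▸ natTrailingDegree_le_natDegree _
  have hltsum : ∑ k, (h k).natTrailingDegree < ∑ k, (h' k).natTrailingDegree := by
    refine Finset.sum_lt_sum (fun k _ => ?_) ⟨i, Finset.mem_univ _, ?_⟩
    · by_cases hk : k = i
      · subst hk; rw [hi', he]; exact htr.le
      · rw [hk' k hk]
    · rw [hi', he]; exact htr
  refine ih _ ?_ h' hm' hd' ?_ ?_ rfl
  · omega
  · rw [hh', wrp_update h i j hij.ne a, hw]
  · have hle : Submodule.span ℂ (Set.range h) ≤ Submodule.span ℂ (Set.range h') := by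
      rw [Submodule.span_le]
      rintro _ ⟨k, rfl⟩
      by_cases hk : k = i
      · subst hk
        have : h k = h' k - a • h' j := by
          rw [hi', hk' j hij.ne', smul_eq_C_mul]; ring
        rw [this]
        exact sub_mem (Submodule.subset_span ⟨k, rfl⟩)
          (Submodule.smul_mem _ _ (Submodule.subset_span ⟨j, rfl⟩))
      · exact Submodule.subset_span ⟨k, hk' k hk⟩
    exact fun k => hle (hg k)

/-- If `wrp g` is a monomial, `g` lies in the span of monomials. -/
theorem mono_fiber {N : ℕ} (d : Fin N → ℕ) (hd : StrictAnti d) (g : Fin N → ℂ[X]) (γ : ℂ)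
    (hm : ∀ i, (g i).Monic) (hdeg : ∀ i, (g i).natDegree = d i)
    (hw : wrp g = C γ * X ^ (∑ i, d i)) (i : Fin N) (k : ℕ) (hk : ∀ j, k ≠ d j) :
    (g i).coeff k = 0 := by
  obtain ⟨h, hm', hd', hw', hg, hinj⟩ := bruhat d hd g _ _ g hm hdeg hw
    (fun i => Submodule.subset_span ⟨i, rfl⟩) rfl
  have h1 := order_lemma h (fun i => (h i).natTrailingDegree) hinj
    (fun i k hk => coeff_eq_zero_of_lt_natTrailingDegree hk)
    (fun i => (trailingCoeff_nonzero_iff_nonzero (p := h i)).2 (hm' i).ne_zero)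
  rw [hw', coeff_C_mul, coeff_X_pow] at h1
  have h2 : ∑ i, (h i).natTrailingDegree = ∑ i, d i := by
    by_contra hne
    simp [hne] at h1
  have h3 := (Finset.sum_eq_sum_iff_of_le
    (fun i _ => hd' i ▸ natTrailingDegree_le_natDegree (h i))).1 h2
  have h4 : ∀ i, h i = X ^ d i := by
    intro i
    have := (hm' i).eq_X_pow_iff_natDegree_le_natTrailingDegree.2
      (by rw [hd', h3 i (Finset.mem_univ _)])
    rw [this, hd']
  have h5 : Submodule.span ℂ (Set.range h) ≤ LinearMap.ker (lcoeff ℂ k) := by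
    rw [Submodule.span_le]
    rintro _ ⟨j, rfl⟩
    simp [h4, coeff_X_pow, hk j]
  exact h5 (hg i)

def QH {σ : Type} (w : σ → ℕ) (D : ℕ) (P : (MvPolynomial σ ℂ)[X]) : Prop :=
  ∀ k a, MvPolynomial.coeff a (P.coeff k) ≠ 0 → Finsupp.weight w a + k = D

theorem QH.add {σ : Type} {w : σ → ℕ} {D : ℕ} {P Q : (MvPolynomial σ ℂ)[X]} (hP : QH w D P)
    (hQ : QH w D Q) : QH w D (P + Q) := by
  intro k a h
  rw [coeff_add, MvPolynomial.coeff_add] at h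
  by_cases h1 : MvPolynomial.coeff a (P.coeff k) = 0
  · exact hQ k a (by simpa [h1] using h)
  · exact hP k a h1

theorem QH.zero {σ : Type} {w : σ → ℕ} {D : ℕ} : QH w D 0 := by
  intro k a h; simp at h

theorem QH.neg {σ : Type} {w : σ → ℕ} {D : ℕ} {P : (MvPolynomial σ ℂ)[X]} (hP : QH w D P) :
    QH w D (-P) := by
  intro k a h
  exact hP k a (by simpa using h)

theorem QH.sum {σ ι : Type} {w : σ → ℕ} {D : ℕ} (s : Finset ι) {P : ι → (MvPolynomial σ ℂ)[X]}
    (hP : ∀ i ∈ s, QH w D (P i)) : QH w D (∑ i ∈ s, P i) :=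
  Finset.sum_induction _ _ (fun _ _ h h' => h.add h') QH.zero hP

theorem QH.mul {σ : Type} {w : σ → ℕ} {D E : ℕ} {P Q : (MvPolynomial σ ℂ)[X]} (hP : QH w D P)
    (hQ : QH w E Q) : QH w (D + E) (P * Q) := by
  classical
  intro k a h
  rw [coeff_mul, MvPolynomial.coeff_sum] at h
  obtain ⟨⟨k1, k2⟩, hk, h⟩ := Finset.exists_ne_zero_of_sum_ne_zero h
  rw [MvPolynomial.coeff_mul] at h
  obtain ⟨⟨a1, a2⟩, ha, h⟩ := Finset.exists_ne_zero_of_sum_ne_zero h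
  rw [Finset.HasAntidiagonal.mem_antidiagonal] at hk ha
  have h1 := hP k1 a1 (left_ne_zero_of_mul h)
  have h2 := hQ k2 a2 (right_ne_zero_of_mul h)
  dsimp only at hk ha
  rw [← hk, ← ha, map_add]
  omega

theorem QH.one {σ : Type} {w : σ → ℕ} : QH w 0 (1 : (MvPolynomial σ ℂ)[X]) := by
  classical
  intro k a h
  rw [coeff_one] at h
  split_ifs at h with hk
  · rw [MvPolynomial.coeff_one] at h
    split_ifs at h with ha
    · subst hk; subst ha; simp
    · simp at h
  · simp at h

theorem QH.prod {σ ι : Type} {w : σ → ℕ} (s : Finset ι) {D : ι → ℕ} {P : ι → (MvPolynomial σ ℂ)[X]}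
    (hP : ∀ i ∈ s, QH w (D i) (P i)) : QH w (∑ i ∈ s, D i) (∏ i ∈ s, P i) := by
  classical
  induction s using Finset.induction_on with
  | empty => simpa using QH.one
  | insert i s hi ih =>
    rw [Finset.sum_insert hi, Finset.prod_insert hi]
    exact (hP i (by simp)).mul (ih fun j hj => hP j (by simp [hj]))

theorem QH.LL {σ : Type} {w : σ → ℕ} {D : ℕ} (j : ℕ) {P : (MvPolynomial σ ℂ)[X]} (hP : QH w D P) :
    QH w D (LL j P) := by
  intro k a h
  rw [LL_coeff] at h
  refine hP k a fun h0 => h ?_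
  rw [← map_natCast (MvPolynomial.C : ℂ →+* MvPolynomial σ ℂ), MvPolynomial.coeff_C_mul, h0, mul_zero]

theorem QH.wrp {σ : Type} {w : σ → ℕ} {N : ℕ} {d : Fin N → ℕ} {F : Fin N → (MvPolynomial σ ℂ)[X]}
    (hF : ∀ i, QH w (d i) (F i)) : QH w (∑ i, d i) (wrp F) := by
  unfold _root_.wrp
  rw [Matrix.det_apply]
  refine QH.sum _ fun τ _ => ?_
  have h : QH w (∑ i, d i) (∏ i, (Matrix.of fun i j : Fin N => _root_.LL (j : ℕ) (F i)) (τ i) i) := by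
    rw [← Equiv.sum_comp τ d]
    exact QH.prod _ fun i _ => (hF _).LL _
  rcases Int.units_eq_one_or (Equiv.Perm.sign τ) with h1 | h1
  · rw [h1, one_smul]; exact h
  · rw [h1, Units.neg_smul, one_smul]; exact h.neg

noncomputable def gp {R : Type*} [CommRing R] {N : ℕ} (d : Fin N → ℕ) (x : (Σ i, Fin (d i)) → R)
    (i : Fin N) : R[X] := X ^ d i + ∑ k : Fin (d i), C (x ⟨i, k⟩) * X ^ (k : ℕ)

theorem gp_map {R S : Type*} [CommRing R] [CommRing S] (φ : R →+* S) {N : ℕ} (d : Fin N → ℕ)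
    (x : (Σ i, Fin (d i)) → R) (i : Fin N) : (gp d x i).map φ = gp d (fun s => φ (x s)) i := by
  simp [gp, Polynomial.map_sum]

theorem gp_coeff_lt {R : Type*} [CommRing R] {N : ℕ} (d : Fin N → ℕ) (x : (Σ i, Fin (d i)) → R)
    (i : Fin N) (k : Fin (d i)) : (gp d x i).coeff k = x ⟨i, k⟩ := by
  unfold gp
  rw [coeff_add, coeff_X_pow, if_neg k.2.ne, zero_add, finsetSum_coeff,
    Finset.sum_eq_single k]
  · simp
  · intro b _ hb
    rw [coeff_C_mul, coeff_X_pow, if_neg (fun h => hb (Fin.ext h.symm)), mul_zero]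
  · simp

theorem gp_lt {R : Type*} [CommRing R] {N : ℕ} (d : Fin N → ℕ)
    (x : (Σ i, Fin (d i)) → R) (i : Fin N) :
    (∑ k : Fin (d i), C (x ⟨i, k⟩) * X ^ (k : ℕ)).degree < (d i : WithBot ℕ) := by
  refine (degree_lt_iff_coeff_zero _ _).2 fun m hm => ?_
  rw [finsetSum_coeff]
  refine Finset.sum_eq_zero fun k _ => ?_
  rw [coeff_C_mul, coeff_X_pow, if_neg, mul_zero]
  have := k.2
  omega

theorem gp_monic {N : ℕ} (d : Fin N → ℕ)
    (x : (Σ i, Fin (d i)) → ℂ) (i : Fin N) : (gp d x i).Monic := by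
  refine (monic_X_pow _).add_of_left ?_
  rw [degree_X_pow]
  exact gp_lt d x i

theorem gp_natDegree {N : ℕ} (d : Fin N → ℕ)
    (x : (Σ i, Fin (d i)) → ℂ) (i : Fin N) : (gp d x i).natDegree = d i := by
  unfold gp
  rw [natDegree_add_eq_left_of_degree_lt, natDegree_X_pow]
  rw [degree_X_pow]
  exact gp_lt d x i

theorem eq_gp {N : ℕ} (d : Fin N → ℕ) (g : Fin N → ℂ[X]) (hg : ∀ i, (g i).natDegree ≤ d i)
    (h1 : ∀ i, (g i).coeff (d i) = 1) : g = gp d (fun s => (g s.1).coeff s.2) := by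
  ext i k
  rcases lt_trichotomy k (d i) with h | h | h
  · exact (gp_coeff_lt d (fun s => (g s.1).coeff s.2) i ⟨k, h⟩).symm
  · subst h
    have := gp_monic d (fun s => (g s.1).coeff s.2) i
    rw [Monic, leadingCoeff, gp_natDegree] at this
    rw [h1, this]
  · rw [coeff_eq_zero_of_natDegree_lt ((hg i).trans_lt h),
      coeff_eq_zero_of_natDegree_lt (by rwa [gp_natDegree])]

def wt {N : ℕ} (d : Fin N → ℕ) (s : Σ i, Fin (d i)) : ℕ := d s.1 - s.2

theorem gp_QH {N : ℕ} (d : Fin N → ℕ) (i : Fin N) :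
    QH (wt d) (d i) (gp d (MvPolynomial.X (R := ℂ)) i) := by
  classical
  refine QH.add ?_ (QH.sum _ fun k _ => ?_)
  · intro k a h
    rw [coeff_X_pow] at h
    split_ifs at h with hk
    · rw [MvPolynomial.coeff_one] at h
      split_ifs at h with ha
      · subst hk; subst ha; simp
      · simp at h
    · simp at h
  · intro l a h
    rw [coeff_C_mul, coeff_X_pow] at h
    split_ifs at h with hk
    · rw [mul_one, MvPolynomial.coeff_X] at h
      split_ifs at h with ha
      · subst hk; subst ha
        have := k.2
        simp [Finsupp.weight_apply, wt]
      · simp at h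
    · simp at h

theorem reduce {N : ℕ} (d : Fin N → ℕ) (hd : StrictAnti d) (f : Fin N → ℂ[X])
    (hm : ∀ i, (f i).Monic) (hdeg : ∀ i, (f i).natDegree = d i) :
    ∃ x : (Σ i, Fin (d i)) → ℂ, wrp (gp d x) = wrp f ∧
      Submodule.span ℂ (Set.range (gp d x)) = Submodule.span ℂ (Set.range f) ∧
      ∀ s, (∃ j, (s.2 : ℕ) = d j) → x s = 0 := by
  classical
  set A : Matrix (Fin N) (Fin N) ℂ := Matrix.of fun i j => (f i).coeff (d j) with hA
  have htri : A.BlockTriangular id := by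
    intro i j hij
    simp only [hA, Matrix.of_apply]
    exact coeff_eq_zero_of_natDegree_lt (by rw [hdeg]; exact hd hij)
  have hdet : A.det = 1 := by
    rw [Matrix.det_of_isUpperTriangular htri]
    refine Finset.prod_eq_one fun i _ => ?_
    have := hm i
    rw [Monic, leadingCoeff, hdeg] at this
    exact this
  have hu : IsUnit A.det := by rw [hdet]; exact isUnit_one
  let _ := Matrix.invertibleOfIsUnitDet A hu
  have htri' : (A⁻¹).BlockTriangular id := Matrix.blockTriangular_inv_of_blockTriangular htri
  set g : Fin N → ℂ[X] := fun i => ∑ k, C (A⁻¹ i k) * f k with hg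
  have hdet' : (A⁻¹).det = 1 := by simp [Matrix.det_nonsing_inv, hdet]
  have hw : wrp g = wrp f := by
    rw [wrp_lin g f A⁻¹ fun i => rfl, hdet']; simp
  have hc : ∀ i j, (g i).coeff (d j) = if i = j then 1 else 0 := by
    intro i j
    have : (A⁻¹ * A) i j = (g i).coeff (d j) := by
      simp [Matrix.mul_apply, hg, hA]
    rw [← this, Matrix.nonsing_inv_mul A hu, Matrix.one_apply]
  have hfg : ∀ i, f i = ∑ k, C (A i k) * g k := by
    intro i
    have : ∀ j, (A * A⁻¹) i j = if i = j then 1 else 0 := by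
      intro j; rw [Matrix.mul_nonsing_inv A hu, Matrix.one_apply]
    simp only [hg, Finset.mul_sum, ← mul_assoc, ← C_mul]
    rw [Finset.sum_comm]
    simp only [← Finset.sum_mul, ← map_sum, ← Matrix.mul_apply, this]
    simp
  have hgd : ∀ i, (g i).natDegree ≤ d i := by
    intro i
    refine natDegree_sum_le_of_forall_le _ _ fun k _ => ?_
    by_cases hk : k < i
    · rw [htri' hk]; simp
    · refine (natDegree_C_mul_le _ _).trans ?_
      rw [hdeg]; exact hd.antitone (not_lt.1 hk)
  have hgx := eq_gp d g hgd (fun i => by simp [hc])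
  refine ⟨fun s => (g s.1).coeff s.2, ?_, ?_, ?_⟩
  · rw [← hgx, hw]
  · rw [← hgx]
    refine le_antisymm (Submodule.span_le.2 ?_) (Submodule.span_le.2 ?_)
    · rintro _ ⟨i, rfl⟩
      refine sum_mem fun k _ => ?_
      rw [← smul_eq_C_mul]
      exact Submodule.smul_mem _ _ (Submodule.subset_span ⟨k, rfl⟩)
    · rintro _ ⟨i, rfl⟩
      rw [hfg]
      refine sum_mem fun k _ => ?_
      rw [← smul_eq_C_mul]
      exact Submodule.smul_mem _ _ (Submodule.subset_span ⟨k, rfl⟩)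
  · rintro ⟨i, k⟩ ⟨j, hj⟩
    dsimp only at hj ⊢
    rw [hj, hc, if_neg]
    rintro rfl
    exact k.2.ne hj

theorem main_aux {N : ℕ} (d : Fin N → ℕ) (hd : StrictAnti d) (V : ℂ[X]) (hV : V.Monic)
    (hVd : V.natDegree = ∑ i, d i) :
    {Y : Submodule ℂ ℂ[X] | ∃ f : Fin N → ℂ[X], (∀ i, (f i).Monic) ∧ (∀ i, (f i).natDegree = d i) ∧
      Submodule.span ℂ (Set.range f) = Y ∧ ∃ c : ℂ, wrp f = C c * V}.Finite := by
  classical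
  set D := ∑ i, d i with hD
  set P := wrp (gp d (MvPolynomial.X (R := ℂ))) with hP
  have hQH : QH (wt d) D P := QH.wrp fun i => gp_QH d i
  have hev : ∀ x, P.map (MvPolynomial.eval x) = wrp (gp d x) := by
    intro x
    rw [hP, wrp_map]
    congr 1
    ext1 i
    rw [gp_map]
    congr 1
    ext s
    simp
  have hevc : ∀ x k, (wrp (gp d x)).coeff k = MvPolynomial.eval x (P.coeff k) := by
    intro x k; rw [← hev, coeff_map]
  have hwt : ∀ s, 0 < wt d s := fun s => Nat.sub_pos_of_lt s.2.2
  set γ : ℂ := MvPolynomial.coeff 0 (P.coeff D) with hγ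
  have hPD : P.coeff D = MvPolynomial.C γ := by
    ext a
    rw [MvPolynomial.coeff_C]
    split_ifs with ha
    · rw [← ha]
    · by_contra h
      have h1 := hQH D a h
      have h2 : Finsupp.weight (wt d) a = 0 := by omega
      refine ha (Finsupp.ext fun s => ?_)
      by_contra hs
      have h3 := Finsupp.le_weight (wt d) (hwt s).ne' a
      have hs' : 0 < a s := Nat.pos_of_ne_zero fun h0 => hs (by rw [h0]; rfl)
      omega
  have hlarge : ∀ k, D < k → P.coeff k = 0 := by
    intro k hk
    ext a
    by_contra h
    have := hQH k a h
    omega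
  set Φ : Fin D ⊕ (Σ i, Fin (d i)) → MvPolynomial (Σ i, Fin (d i)) ℂ :=
    Sum.elim (fun t => P.coeff t) (fun s => if ∃ j, (s.2 : ℕ) = d j then MvPolynomial.X s else 0)
    with hΦ
  have hfin := finite_fiber (wt d) Φ (Sum.elim (fun t => D - t) (wt d)) ?_ ?_ ?_
    (Sum.elim (fun t => γ * V.coeff t) (fun _ => 0))
  · refine (hfin.image fun x => Submodule.span ℂ (Set.range (gp d x))).subset ?_
    rintro Y ⟨f, hm, hdeg, rfl, c, hc⟩
    obtain ⟨x, hx, hsp, hx0⟩ := reduce d hd f hm hdeg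
    refine ⟨x, ?_, hsp⟩
    have hcγ : c = γ := by
      have h1 := hevc x D
      rw [hPD, MvPolynomial.eval_C, hx, hc, coeff_C_mul, ← hVd, ← leadingCoeff, hV.leadingCoeff,
        mul_one] at h1
      exact h1
    rintro (t | s)
    · simp only [hΦ, Sum.elim_inl]
      rw [← hevc, hx, hc, coeff_C_mul, hcγ]
    · simp only [hΦ, Sum.elim_inr]
      split_ifs with h
      · simpa using hx0 s h
      · simp
  · rintro (t | s)
    · exact Nat.sub_pos_of_lt t.2
    · exact hwt s
  · rintro (t | s)
    · intro a ha
      have := hQH t a ha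
      simp only [Sum.elim_inl]
      omega
    · simp only [hΦ, Sum.elim_inr]
      split_ifs
      · exact MvPolynomial.isWeightedHomogeneous_X _ _ _
      · exact MvPolynomial.isWeightedHomogeneous_zero _ _ _
  · intro x hx
    have hw : wrp (gp d x) = C γ * X ^ D := by
      ext k
      rw [hevc, coeff_C_mul, coeff_X_pow]
      rcases lt_trichotomy k D with h | h | h
      · rw [if_neg h.ne, mul_zero]
        exact hx (Sum.inl ⟨k, h⟩)
      · subst h; simp [hPD]
      · rw [hlarge k h, if_neg h.ne']; simp
    ext ⟨i, k⟩
    by_cases h : ∃ j, (k : ℕ) = d j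
    · have := hx (Sum.inr ⟨i, k⟩)
      simpa [hΦ, h] using this
    · push Not at h
      have := mono_fiber d hd (gp d x) γ (gp_monic d x) (gp_natDegree d x) hw i k h
      rwa [gp_coeff_lt] at this

end

/-- Let λ be a partition with at most N parts, n = |λ|, d_i = λ_i + N − i
(0-based: d_i = λ_i + (N−1−i)).  For any monic polynomial W of degree n, the set of
N-dimensional subspaces X ⊂ ℂ[u] having a basis of monic polynomials of degrees
d₁,…,d_N whose monic Wronskian equals W is finite. -/
theorem stmt_12 (N : ℕ) (hN : 1 ≤ N)
    (lam : Fin N → ℕ) (hlam : Antitone lam)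
    (W : Polynomial ℂ) (hW : W.Monic) (hWdeg : W.natDegree = ∑ i, lam i) :
    {X : Submodule ℂ (Polynomial ℂ) |
      ∃ f : Fin N → Polynomial ℂ,
        (∀ i, f i ∈ X ∧ (f i).Monic ∧ (f i).natDegree = lam i + (N - 1 - (i : ℕ))) ∧
        LinearIndependent ℂ f ∧
        Submodule.span ℂ (Set.range f) = X ∧
        ∃ c : ℂ, c ≠ 0 ∧ wron N f = Polynomial.C c * W}.Finite := by
  have hd : StrictAnti fun i : Fin N => lam i + (N - 1 - (i : ℕ)) := by
    intro i j hij
    have := hlam hij.le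
    have h1 : (i : ℕ) < j := hij
    have h2 := j.2
    dsimp only
    omega
  have hsum : ∑ j : Fin N, (j : ℕ) = ∑ i : Fin N, (N - 1 - (i : ℕ)) := by
    rw [← Equiv.sum_comp Fin.revPerm]
    refine Finset.sum_congr rfl fun i _ => ?_
    simp only [Fin.revPerm_apply, Fin.val_rev]
    omega
  have hmon : ((Polynomial.X : Polynomial ℂ) ^ (∑ j : Fin N, (j : ℕ)) * W).Monic :=
    (Polynomial.monic_X_pow _).mul hW
  refine (main_aux _ hd (Polynomial.X ^ (∑ j : Fin N, (j : ℕ)) * W) hmon ?_).subset ?_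
  · rw [(Polynomial.monic_X_pow _).natDegree_mul hW, Polynomial.natDegree_X_pow, hWdeg, hsum,
      Finset.sum_add_distrib, add_comm]
  · rintro Y ⟨f, hf, _, hsp, c, _, hw⟩
    refine ⟨f, fun i => (hf i).2.1, fun i => (hf i).2.2, hsp, c, ?_⟩
    rw [wrp_eq]
    change _ * wron N f = _
    rw [hw]; ring
end
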